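/- arXiv:1811.05595 — 2 statements merged into one kernel-verified Lean document; each statement's English description precedes it below -/
import Mathlib

section
/- Fix constants μ > 0, σ_a, σ_s ≥ 0 with σ_a² + σ_s² > 0, and A_max, S_max > 0. For each ε ∈ (0, μ), let q_ε, a_ε, s_ε be real random variables on a probability space such that: q_ε ≥ 0 almost surely; 0 ≤ a_ε ≤ A_max and 0 ≤ s_ε ≤ S_max almost surely; the pair (a_ε, s_ε) is independent of q_ε and a_ε is independent of s_ε; E[a_ε] = μ − ε, E[s_ε] = μ, Var(s_ε) = σ_s², and Var(a_ε) = (σ_a^{(ε)})² with σ_a^{(ε)} → σ_a as ε → 0⁺; the random variable q_ε⁺ := max(q_ε + a_ε − s_ε, 0) is identically distributed with q_ε; and there exists Θ > 0, independent of ε, with E[exp(θ ε q_ε)] < ∞ for all |θ| ≤ Θ. Then, as ε → 0⁺, the law of ε·q_ε converges weakly to the exponential distribution with mean (σ_a² + σ_s²)/2. -/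
open MeasureTheory ProbabilityTheory Filter Topology

/-- First-order Taylor estimate for `x ↦ exp (i x)`. -/
lemma norm_cexp_mul_I_sub_le {x : ℝ} (hx : |x| ≤ 1) :
    ‖Complex.exp (x * Complex.I) - 1 - x * Complex.I‖ ≤ x ^ 2 := by
  simpa using Complex.norm_exp_sub_one_sub_id_le (x := x * Complex.I) (by simpa using hx)

/-- Second-order Taylor estimate for `x ↦ exp (i x)`. -/
lemma norm_cexp_mul_I_sub_add_le {x : ℝ} (hx : |x| ≤ 1) :
    ‖Complex.exp (x * Complex.I) - 1 - x * Complex.I + (x ^ 2 / 2 : ℝ)‖ ≤ |x| ^ 3 := by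
  have h := Complex.exp_bound (x := x * Complex.I) (by simpa using hx) (n := 3) (by norm_num)
  have e : Complex.exp (x * Complex.I) - 1 - x * Complex.I + (x ^ 2 / 2 : ℝ) =
      Complex.exp (x * Complex.I)
        - ∑ m ∈ Finset.range 3, (x * Complex.I) ^ m / (m.factorial : ℂ) := by
    simp [Finset.sum_range_succ, Nat.factorial, mul_pow]
    ring
  rw [e]
  refine h.trans ?_
  have : 0 ≤ |x| ^ 3 := by positivity
  norm_num [Nat.factorial]
  linarith

/-- The characteristic function of the exponential distribution with rate `r`. -/
lemma charFun_expMeasure {r : ℝ} (hr : 0 < r) (t : ℝ) :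
    charFun (expMeasure r) t = r / (r - t * Complex.I) := by
  have hpdf (x : ℝ) : ((gammaPDF 1 r x).toReal • Complex.exp (t * x * Complex.I) : ℂ) =
      (Set.Ici (0 : ℝ)).indicator
        (fun x : ℝ => (r : ℂ) * Complex.exp ((-r + t * Complex.I) * x)) x := by
    by_cases hx : 0 ≤ x
    · have h0 : 0 ≤ r * Real.exp (-(r * x)) := by positivity
      rw [Set.indicator_of_mem (Set.mem_Ici.2 hx), gammaPDF_of_nonneg hx]
      simp only [Real.rpow_one, Real.Gamma_one, div_one, sub_self, Real.rpow_zero, mul_one]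
      rw [ENNReal.toReal_ofReal h0, Complex.real_smul]
      push_cast
      rw [mul_assoc, ← Complex.exp_add]
      ring_nf
    · rw [Set.indicator_of_notMem (by simpa using hx), gammaPDF_of_neg (not_le.1 hx)]
      simp
  have hne : (r : ℂ) - t * Complex.I ≠ 0 := fun h => hr.ne' (by simpa using congrArg Complex.re h)
  have hne' : -(r : ℂ) + t * Complex.I ≠ 0 := fun h => hne (by linear_combination -h)
  rw [charFun_apply_real, expMeasure, gammaMeasure,
    integral_withDensity_eq_integral_toReal_smul
      (f := gammaPDF 1 r) (measurable_gammaPDFReal 1 r).ennreal_ofReal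
      (by simp [gammaPDF])]
  simp_rw [hpdf]
  rw [integral_indicator measurableSet_Ici, integral_Ici_eq_integral_Ioi,
    integral_const_mul, integral_exp_mul_complex_Ioi (by simpa using hr)]
  field_simp
  simp
  ring

/-- A nonnegative variable with a finite exponential moment is integrable. -/
lemma integrable_of_integrable_exp_mul {Ω : Type*} [MeasurableSpace Ω] {P : Measure Ω}
    {q : Ω → ℝ} {c : ℝ} (hq : Measurable q)
    (hq0 : ∀ᵐ ω ∂P, 0 ≤ q ω) (hc : 0 < c) (h : Integrable (fun ω => Real.exp (c * q ω)) P) :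
    Integrable q P := by
  refine (h.const_mul c⁻¹).mono' hq.aestronglyMeasurable ?_
  filter_upwards [hq0] with ω h0
  rw [Real.norm_of_nonneg h0, ← div_eq_inv_mul, le_div_iff₀ hc]
  linarith [Real.add_one_le_exp (c * q ω)]

section SingleMeasure

variable {Ω : Type*} [MeasurableSpace Ω] {P : Measure Ω} [IsProbabilityMeasure P]

lemma integrable_cexp_mul_I {Y : Ω → ℝ} (hY : Measurable Y) :
    Integrable (fun ω => Complex.exp (Y ω * Complex.I)) P :=
  Integrable.of_bound (by fun_prop) 1 (ae_of_all _ fun ω => by simp)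

/-- First-order expansion of the characteristic function of a bounded nonnegative variable,
with an error controlled by its mean. -/
lemma norm_integral_cexp_sub_le {Y : Ω → ℝ} {M w : ℝ} (hY : Measurable Y)
    (hb : ∀ᵐ ω ∂P, Y ω ∈ Set.Icc 0 M) (hw : |w| * M ≤ 1) :
    ‖∫ ω, Complex.exp ((w * Y ω : ℝ) * Complex.I) ∂P - 1 - (w * ∫ ω, Y ω ∂P : ℝ) * Complex.I‖
      ≤ w ^ 2 * M * ∫ ω, Y ω ∂P := by
  have hYi : Integrable Y P := Integrable.of_bound hY.aestronglyMeasurable M <| by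
    filter_upwards [hb] with ω h
    rw [Real.norm_of_nonneg h.1]
    exact h.2
  have he := integrable_cexp_mul_I (P := P) (hY.const_mul w)
  have he1 : Integrable (fun ω => Complex.exp ((w * Y ω : ℝ) * Complex.I) - 1) P :=
    he.sub (integrable_const _)
  have hlin : Integrable (fun ω => ((w * Y ω : ℝ) : ℂ) * Complex.I) P :=
    ((hYi.const_mul w).ofReal).mul_const _
  have heq : ∫ ω, Complex.exp ((w * Y ω : ℝ) * Complex.I) ∂P - 1
      - (w * ∫ ω, Y ω ∂P : ℝ) * Complex.I =
      ∫ ω, (Complex.exp ((w * Y ω : ℝ) * Complex.I) - 1 - (w * Y ω : ℝ) * Complex.I) ∂P := by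
    rw [integral_sub he1 hlin, integral_sub he (integrable_const _),
      integral_mul_const, integral_complex_ofReal, integral_const_mul]
    simp
  rw [heq, ← integral_const_mul]
  refine norm_integral_le_of_norm_le (hYi.const_mul _) ?_
  filter_upwards [hb] with ω h
  refine (norm_cexp_mul_I_sub_le ?_).trans ?_
  · rw [abs_mul, abs_of_nonneg h.1]
    exact (mul_le_mul_of_nonneg_left h.2 (abs_nonneg w)).trans hw
  · have := mul_le_mul_of_nonneg_left (mul_le_mul_of_nonneg_right h.2 h.1) (sq_nonneg w)
    nlinarith

/-- Second-order expansion of the characteristic function of a bounded variable. -/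
lemma norm_integral_cexp_sub_add_le {X : Ω → ℝ} {M w : ℝ} (hX : Measurable X)
    (hb : ∀ᵐ ω ∂P, |X ω| ≤ M) (hw : |w| * M ≤ 1) :
    ‖∫ ω, Complex.exp ((w * X ω : ℝ) * Complex.I) ∂P - 1 - (w * ∫ ω, X ω ∂P : ℝ) * Complex.I
      + (w ^ 2 / 2 * ∫ ω, X ω ^ 2 ∂P : ℝ)‖ ≤ (|w| * M) ^ 3 := by
  have hXi : Integrable X P := Integrable.of_bound hX.aestronglyMeasurable M hb
  have hX2 : Integrable (fun ω => X ω ^ 2) P :=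
    Integrable.of_bound (hX.pow_const 2).aestronglyMeasurable (M ^ 2) <| by
      filter_upwards [hb] with ω h
      rw [norm_pow]
      exact pow_le_pow_left₀ (norm_nonneg _) h 2
  have he := integrable_cexp_mul_I (P := P) (hX.const_mul w)
  have he1 : Integrable (fun ω => Complex.exp ((w * X ω : ℝ) * Complex.I) - 1) P :=
    he.sub (integrable_const _)
  have hlin : Integrable (fun ω => ((w * X ω : ℝ) : ℂ) * Complex.I) P :=
    ((hXi.const_mul w).ofReal).mul_const _
  have he2 : Integrable (fun ω => Complex.exp ((w * X ω : ℝ) * Complex.I) - 1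
      - (w * X ω : ℝ) * Complex.I) P := he1.sub hlin
  have hquad : Integrable (fun ω => ((w ^ 2 / 2 * X ω ^ 2 : ℝ) : ℂ)) P :=
    (hX2.const_mul (w ^ 2 / 2)).ofReal
  have heq : ∫ ω, Complex.exp ((w * X ω : ℝ) * Complex.I) ∂P - 1
      - (w * ∫ ω, X ω ∂P : ℝ) * Complex.I + (w ^ 2 / 2 * ∫ ω, X ω ^ 2 ∂P : ℝ) =
      ∫ ω, (Complex.exp ((w * X ω : ℝ) * Complex.I) - 1 - (w * X ω : ℝ) * Complex.I
        + (w ^ 2 / 2 * X ω ^ 2 : ℝ)) ∂P := by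
    rw [integral_add he2 hquad,
      integral_sub he1 hlin, integral_sub he (integrable_const _),
      integral_mul_const, integral_complex_ofReal, integral_complex_ofReal, integral_const_mul,
      integral_const_mul]
    simp
  have hconst : (|w| * M) ^ 3 = ∫ _, (|w| * M) ^ 3 ∂P := by simp
  rw [heq, hconst]
  refine norm_integral_le_of_norm_le (integrable_const _) ?_
  filter_upwards [hb] with ω h
  have hle : |w * X ω| ≤ |w| * M := by
    rw [abs_mul]
    exact mul_le_mul_of_nonneg_left h (abs_nonneg w)
  have := norm_cexp_mul_I_sub_add_le (hle.trans hw)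
  rw [mul_pow, mul_div_right_comm] at this
  exact this.trans (pow_le_pow_left₀ (abs_nonneg _) hle 3)

/-- The functional equation of the stationary queue: the idle time `u = q⁺ - (q + X)` satisfies
`q⁺ u = 0`, hence `exp (i w q⁺) + exp (-i w u) = 1 + exp (i w (q + X))`. -/
lemma stationary_queue_charFun {q X : Ω → ℝ} (hq : Measurable q) (hX : Measurable X)
    (hind : IndepFun X q P)
    (hstat : Measure.map (fun ω => max (q ω + X ω) 0) P = Measure.map q P) (w : ℝ) :
    (∫ ω, Complex.exp ((w * q ω : ℝ) * Complex.I) ∂P) *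
        (1 - ∫ ω, Complex.exp ((w * X ω : ℝ) * Complex.I) ∂P) =
      1 - ∫ ω, Complex.exp ((-w * (max (q ω + X ω) 0 - (q ω + X ω)) : ℝ) * Complex.I) ∂P := by
  have hqp : Measurable fun ω => max (q ω + X ω) 0 := (hq.add hX).max measurable_const
  have hu : Measurable fun ω => max (q ω + X ω) 0 - (q ω + X ω) := hqp.sub (hq.add hX)
  have hmap : ∫ ω, Complex.exp ((w * max (q ω + X ω) 0 : ℝ) * Complex.I) ∂P
      = ∫ ω, Complex.exp ((w * q ω : ℝ) * Complex.I) ∂P := by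
    have hg (ν : Measure ℝ) :
        AEStronglyMeasurable (fun x : ℝ => Complex.exp ((w * x : ℝ) * Complex.I)) ν := by fun_prop
    rw [← integral_map hqp.aemeasurable (hg _), ← integral_map hq.aemeasurable (hg _), hstat]
  have hmul : ∫ ω, Complex.exp ((w * X ω : ℝ) * Complex.I)
        * Complex.exp ((w * q ω : ℝ) * Complex.I) ∂P =
      (∫ ω, Complex.exp ((w * X ω : ℝ) * Complex.I) ∂P)
        * ∫ ω, Complex.exp ((w * q ω : ℝ) * Complex.I) ∂P := by
    have hm : Measurable fun x : ℝ => Complex.exp ((w * x : ℝ) * Complex.I) := by fun_prop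
    exact (hind.comp hm hm).integral_fun_mul_eq_mul_integral
      (hm.comp hX).aestronglyMeasurable (hm.comp hq).aestronglyMeasurable
  have hpt (ω : Ω) : Complex.exp ((w * X ω : ℝ) * Complex.I)
        * Complex.exp ((w * q ω : ℝ) * Complex.I) =
      Complex.exp ((w * max (q ω + X ω) 0 : ℝ) * Complex.I)
        + Complex.exp ((-w * (max (q ω + X ω) 0 - (q ω + X ω)) : ℝ) * Complex.I) - 1 := by
    rw [← Complex.exp_add]
    rcases le_total (q ω + X ω) 0 with h | h
    · rw [max_eq_right h]
      simp
      ring_nf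
    · rw [max_eq_left h]
      simp
      ring_nf
  simp_rw [hpt] at hmul
  have h1 := integrable_cexp_mul_I (P := P) (hqp.const_mul w)
  have h2 := integrable_cexp_mul_I (P := P) (hu.const_mul (-w))
  have h12 : Integrable (fun ω => Complex.exp ((w * max (q ω + X ω) 0 : ℝ) * Complex.I)
      + Complex.exp ((-w * (max (q ω + X ω) 0 - (q ω + X ω)) : ℝ) * Complex.I)) P := h1.add h2
  rw [integral_sub h12 (integrable_const _), integral_add h1 h2, hmap] at hmul
  simp only [integral_const, probReal_univ, one_smul] at hmul
  linear_combination hmul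

/-- In a stationary queue the mean idle time is the negative of the mean drift. -/
lemma stationary_queue_integral_idle {q X : Ω → ℝ} (hq : Measurable q) (hX : Measurable X)
    (hqi : Integrable q P) (hXi : Integrable X P)
    (hstat : Measure.map (fun ω => max (q ω + X ω) 0) P = Measure.map q P) :
    ∫ ω, (max (q ω + X ω) 0 - (q ω + X ω)) ∂P = -∫ ω, X ω ∂P := by
  have hqp : Measurable fun ω => max (q ω + X ω) 0 := (hq.add hX).max measurable_const
  have hmap : ∫ ω, max (q ω + X ω) 0 ∂P = ∫ ω, q ω ∂P := by
    have h1 := integral_map (μ := P) hqp.aemeasurable (f := fun x : ℝ => x) (by fun_prop)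
    have h2 := integral_map (μ := P) hq.aemeasurable (f := fun x : ℝ => x) (by fun_prop)
    rw [← h1, ← h2, hstat]
  have hs : Integrable (fun ω => q ω + X ω) P := hqi.add hXi
  have hp : Integrable (fun ω => max (q ω + X ω) 0) P := hs.sup (integrable_const 0)
  rw [integral_sub hp hs, integral_add hqi hXi, hmap]
  ring

/-- Second moment of the difference of two independent bounded variables. -/
lemma integral_sub_sq_of_indepFun {a s : Ω → ℝ} {A S : ℝ} (ha : Measurable a) (hs : Measurable s)
    (hab : ∀ᵐ ω ∂P, |a ω| ≤ A) (hsb : ∀ᵐ ω ∂P, |s ω| ≤ S) (hind : IndepFun a s P) :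
    ∫ ω, (a ω - s ω) ^ 2 ∂P = ∫ ω, (a ω - ∫ x, a x ∂P) ^ 2 ∂P + ∫ ω, (s ω - ∫ x, s x ∂P) ^ 2 ∂P
      + (∫ ω, a ω ∂P - ∫ ω, s ω ∂P) ^ 2 := by
  have ha2 : MemLp a 2 P := MemLp.of_bound ha.aestronglyMeasurable A hab
  have hs2 : MemLp s 2 P := MemLp.of_bound hs.aestronglyMeasurable S hsb
  have hva := variance_eq_sub ha2
  have hvs := variance_eq_sub hs2
  rw [variance_eq_integral ha.aemeasurable] at hva
  rw [variance_eq_integral hs.aemeasurable] at hvs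
  have hmul := hind.integral_fun_mul_eq_mul_integral ha.aestronglyMeasurable
    hs.aestronglyMeasurable
  have hexp : ∫ ω, (a ω - s ω) ^ 2 ∂P
      = ∫ ω, (a ω ^ 2 - 2 * (a ω * s ω) + s ω ^ 2) ∂P := by
    congr with ω
    ring
  have hi : Integrable (fun ω => 2 * (a ω * s ω)) P := (ha2.integrable_mul hs2).const_mul 2
  have hd : Integrable (fun ω => a ω ^ 2 - 2 * (a ω * s ω)) P := ha2.integrable_sq.sub hi
  rw [hexp, integral_add hd hs2.integrable_sq,
    integral_sub ha2.integrable_sq hi, integral_const_mul, hmul, hva, hvs]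
  simp only [Pi.pow_apply]
  ring

end SingleMeasure

/-- Quotient form of the heavy-traffic limit: asymptotics of numerator and denominator at
scale `ε²` determine the limit of a function solving `φ D = N`. -/
lemma tendsto_of_mul_eq_of_norm_sub_le {φ D N : ℝ → ℂ} {V : ℝ → ℝ} {σ2 t C K δ : ℝ}
    (hδ : 0 < δ) (ht : t ≠ 0) (hσ : 0 < σ2) (hV : Tendsto V (𝓝[>] 0) (𝓝 σ2))
    (heq : ∀ ε ∈ Set.Ioo 0 δ, φ ε * D ε = N ε)
    (hN : ∀ ε ∈ Set.Ioo 0 δ, ‖N ε - (t * ε ^ 2 : ℝ) * Complex.I‖ ≤ C * ε ^ 3)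
    (hD : ∀ ε ∈ Set.Ioo 0 δ,
      ‖D ε - ((t * ε ^ 2 : ℝ) * Complex.I + (t ^ 2 * ε ^ 2 / 2 * V ε : ℝ))‖ ≤ K * ε ^ 3) :
    Tendsto φ (𝓝[>] 0) (𝓝 ((2 / σ2 : ℝ) / ((2 / σ2 : ℝ) - t * Complex.I))) := by
  have hev : ∀ᶠ ε in 𝓝[>] (0 : ℝ), ε ∈ Set.Ioo 0 δ := Ioo_mem_nhdsGT hδ
  have hε : Tendsto (fun ε : ℝ => ε) (𝓝[>] 0) (𝓝 0) := tendsto_nhdsWithin_of_tendsto_nhds tendsto_id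
  have hscale {Z : ℂ} {B ε : ℝ} (h0 : 0 < ε) (h : ‖Z‖ ≤ B * ε ^ 3) :
      ‖Z / (ε : ℂ) ^ 2‖ ≤ B * ε := by
    rw [norm_div, norm_pow, Complex.norm_real, Real.norm_of_nonneg h0.le,
      div_le_iff₀ (by positivity)]
    linarith
  have hNlim : Tendsto (fun ε => N ε / (ε : ℂ) ^ 2) (𝓝[>] 0) (𝓝 (t * Complex.I)) := by
    rw [← tendsto_sub_nhds_zero_iff]
    refine squeeze_zero_norm' (a := fun ε => C * ε) ?_ (by simpa using hε.const_mul C)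
    filter_upwards [hev] with ε h
    refine (le_of_eq ?_).trans (hscale h.1 (hN ε h))
    congr 1
    have : (ε : ℂ) ≠ 0 := by exact_mod_cast h.1.ne'
    push_cast
    field_simp
  have hDlim : Tendsto (fun ε => D ε / (ε : ℂ) ^ 2) (𝓝[>] 0)
      (𝓝 (t * Complex.I + (t ^ 2 / 2 * σ2 : ℝ))) := by
    have hVlim : Tendsto (fun ε => (t * Complex.I + (t ^ 2 / 2 * V ε : ℝ) : ℂ)) (𝓝[>] 0)
        (𝓝 (t * Complex.I + (t ^ 2 / 2 * σ2 : ℝ))) :=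
      tendsto_const_nhds.add ((Complex.continuous_ofReal.tendsto _).comp (hV.const_mul _))
    have hdiff : Tendsto (fun ε => D ε / (ε : ℂ) ^ 2
        - (t * Complex.I + (t ^ 2 / 2 * V ε : ℝ) : ℂ)) (𝓝[>] 0) (𝓝 0) := by
      refine squeeze_zero_norm' (a := fun ε => K * ε) ?_ (by simpa using hε.const_mul K)
      filter_upwards [hev] with ε h
      refine (le_of_eq ?_).trans (hscale h.1 (hD ε h))
      congr 1
      have : (ε : ℂ) ≠ 0 := by exact_mod_cast h.1.ne'
      push_cast
      field_simp
    simpa using hdiff.add hVlim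
  have htC : (t : ℂ) ≠ 0 := by exact_mod_cast ht
  have hσC : (σ2 : ℂ) ≠ 0 := by exact_mod_cast hσ.ne'
  have hne : (t * Complex.I + (t ^ 2 / 2 * σ2 : ℝ) : ℂ) ≠ 0 := fun h => ht (by
    simpa [-Complex.ofReal_mul, -Complex.ofReal_div, -Complex.ofReal_pow]
      using congrArg Complex.im h)
  have hne' : ((2 / σ2 : ℝ) - t * Complex.I : ℂ) ≠ 0 := fun h => by
    have := congrArg Complex.re h
    rw [Complex.sub_re, Complex.ofReal_re] at this
    simp [hσ.ne'] at this
  have hlim : ((2 / σ2 : ℝ) / ((2 / σ2 : ℝ) - t * Complex.I) : ℂ) =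
      t * Complex.I / (t * Complex.I + (t ^ 2 / 2 * σ2 : ℝ)) := by
    rw [div_eq_div_iff hne' hne]
    push_cast
    field_simp
    linear_combination ((t : ℂ) * σ2) * Complex.I_sq
  rw [hlim]
  refine (hNlim.div hDlim hne).congr' ?_
  filter_upwards [hev, hDlim.eventually_ne hne] with ε h hDne
  have hε0 : (ε : ℂ) ≠ 0 := by exact_mod_cast h.1.ne'
  have hD0 : D ε ≠ 0 := fun h0 => hDne (by simp [h0])
  rw [Pi.div_apply, ← heq ε h]
  field_simp

/-- Heavy-traffic limit of the single server queue: under the stated assumptions,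
the law of `ε·q_ε` converges weakly, as `ε → 0⁺`, to the exponential distribution
with mean `(σ_a² + σ_s²)/2` (i.e. rate `2/(σ_a² + σ_s²)`). -/
theorem stmt0
    (μ σa σs Amax Smax : ℝ)
    (hμ : 0 < μ) (hσa : 0 ≤ σa) (hσs : 0 ≤ σs)
    (hpos : 0 < σa ^ 2 + σs ^ 2) (hA : 0 < Amax) (hS : 0 < Smax)
    (Ω : ℝ → Type) [∀ ε, MeasurableSpace (Ω ε)]
    (P : ∀ ε, Measure (Ω ε)) [∀ ε, IsProbabilityMeasure (P ε)]
    (q a s : ∀ ε, Ω ε → ℝ) (σa' : ℝ → ℝ)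
    (hmq : ∀ ε, Measurable (q ε)) (hma : ∀ ε, Measurable (a ε))
    (hms : ∀ ε, Measurable (s ε))
    (hq0 : ∀ ε ∈ Set.Ioo 0 μ, ∀ᵐ ω ∂(P ε), 0 ≤ q ε ω)
    (ha_bdd : ∀ ε ∈ Set.Ioo 0 μ, ∀ᵐ ω ∂(P ε), a ε ω ∈ Set.Icc 0 Amax)
    (hs_bdd : ∀ ε ∈ Set.Ioo 0 μ, ∀ᵐ ω ∂(P ε), s ε ω ∈ Set.Icc 0 Smax)
    (h_as_q : ∀ ε ∈ Set.Ioo 0 μ, IndepFun (fun ω => (a ε ω, s ε ω)) (q ε) (P ε))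
    (h_a_s : ∀ ε ∈ Set.Ioo 0 μ, IndepFun (a ε) (s ε) (P ε))
    (hEa : ∀ ε ∈ Set.Ioo 0 μ, ∫ ω, a ε ω ∂(P ε) = μ - ε)
    (hEs : ∀ ε ∈ Set.Ioo 0 μ, ∫ ω, s ε ω ∂(P ε) = μ)
    (hVars : ∀ ε ∈ Set.Ioo 0 μ, ∫ ω, (s ε ω - μ) ^ 2 ∂(P ε) = σs ^ 2)
    (hVara : ∀ ε ∈ Set.Ioo 0 μ, ∫ ω, (a ε ω - (μ - ε)) ^ 2 ∂(P ε) = (σa' ε) ^ 2)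
    (hσa'lim : Tendsto σa' (𝓝[>] 0) (𝓝 σa))
    (hstat : ∀ ε ∈ Set.Ioo 0 μ,
      Measure.map (fun ω => max (q ε ω + a ε ω - s ε ω) 0) (P ε)
        = Measure.map (q ε) (P ε))
    (Θ : ℝ) (hΘ : 0 < Θ)
    (hmgf : ∀ ε ∈ Set.Ioo 0 μ, ∀ θ : ℝ, |θ| ≤ Θ →
      Integrable (fun ω => Real.exp (θ * ε * q ε ω)) (P ε)) :
    ∀ f : BoundedContinuousFunction ℝ ℝ,
      Tendsto (fun ε => ∫ ω, f (ε * q ε ω) ∂(P ε)) (𝓝[>] 0)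
        (𝓝 (∫ x, f x ∂(expMeasure (2 / (σa ^ 2 + σs ^ 2))))) := by
  set r : ℝ := 2 / (σa ^ 2 + σs ^ 2)
  have hrpos : 0 < r := by positivity
  have : IsProbabilityMeasure (expMeasure r) := isProbabilityMeasure_expMeasure hrpos
  have hmeas (ε : ℝ) : Measurable fun ω => ε * q ε ω := (hmq ε).const_mul ε
  have hprob (ε : ℝ) : IsProbabilityMeasure (Measure.map (fun ω => ε * q ε ω) (P ε)) :=
    Measure.isProbabilityMeasure_map (hmeas ε).aemeasurable
  let ν (ε : ℝ) : ProbabilityMeasure ℝ := ⟨Measure.map (fun ω => ε * q ε ω) (P ε), hprob ε⟩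
  let ν₀ : ProbabilityMeasure ℝ := ⟨expMeasure r, inferInstance⟩
  have hchar (ε t : ℝ) : charFun (ν ε : Measure ℝ) t
      = ∫ ω, Complex.exp ((t * ε * q ε ω : ℝ) * Complex.I) ∂(P ε) := by
    rw [charFun_apply_real]
    change ∫ x, _ ∂(Measure.map (fun ω => ε * q ε ω) (P ε)) = _
    rw [integral_map (hmeas ε).aemeasurable (by fun_prop)]
    congr with ω
    push_cast
    ring_nf
  suffices hcf : ∀ t : ℝ, Tendsto (fun ε => charFun (ν ε : Measure ℝ) t) (𝓝[>] 0)
      (𝓝 (charFun (ν₀ : Measure ℝ) t)) by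
    have hν : Tendsto ν (𝓝[>] 0) (𝓝 ν₀) := tendsto_of_seq_tendsto fun x hx =>
      ProbabilityMeasure.tendsto_of_tendsto_charFun fun t => (hcf t).comp hx
    intro f
    have hf := ProbabilityMeasure.tendsto_iff_forall_integral_tendsto.1 hν f
    refine hf.congr fun ε => ?_
    exact integral_map (hmeas ε).aemeasurable f.continuous.aestronglyMeasurable
  intro t
  have hν₀ : charFun (ν₀ : Measure ℝ) t = r / (r - t * Complex.I) := charFun_expMeasure hrpos t
  rw [hν₀]
  rcases eq_or_ne t 0 with rfl | ht
  · have : (r : ℂ) ≠ 0 := by exact_mod_cast hrpos.ne'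
    simp [this]
  simp_rw [hchar]
  have hM : 0 < Amax + Smax := by positivity
  set M : ℝ := Amax + Smax
  have htM : 0 < |t| * M := by positivity
  have hδ : 0 < min μ (|t| * M)⁻¹ := by positivity
  let X (ε : ℝ) (ω : Ω ε) : ℝ := a ε ω - s ε ω
  let u (ε : ℝ) (ω : Ω ε) : ℝ := max (q ε ω + X ε ω) 0 - (q ε ω + X ε ω)
  have hXm (ε : ℝ) : Measurable (X ε) := (hma ε).sub (hms ε)
  have hum (ε : ℝ) : Measurable (u ε) :=
    (((hmq ε).add (hXm ε)).max measurable_const).sub ((hmq ε).add (hXm ε))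
  have hXb {ε : ℝ} (hε : ε ∈ Set.Ioo 0 μ) : ∀ᵐ ω ∂(P ε), |X ε ω| ≤ M := by
    filter_upwards [ha_bdd ε hε, hs_bdd ε hε] with ω h1 h2
    exact abs_le.2 ⟨by linarith [h1.1, h2.2], by linarith [h1.2, h2.1]⟩
  have hub {ε : ℝ} (hε : ε ∈ Set.Ioo 0 μ) : ∀ᵐ ω ∂(P ε), u ε ω ∈ Set.Icc 0 M := by
    filter_upwards [hXb hε, hq0 ε hε] with ω h1 h2
    refine ⟨sub_nonneg.2 (le_max_left _ _), ?_⟩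
    have := (abs_le.1 h1).1
    exact sub_le_iff_le_add.2 (max_le (by linarith) (by linarith))
  have hstatX {ε : ℝ} (hε : ε ∈ Set.Ioo 0 μ) :
      Measure.map (fun ω => max (q ε ω + X ε ω) 0) (P ε) = Measure.map (q ε) (P ε) := by
    rw [← hstat ε hε]
    simp only [X, add_sub_assoc]
  have hEX {ε : ℝ} (hε : ε ∈ Set.Ioo 0 μ) : ∫ ω, X ε ω ∂(P ε) = -ε := by
    have hai : Integrable (a ε) (P ε) := Integrable.of_bound (hma ε).aestronglyMeasurable Amax <| by
      filter_upwards [ha_bdd ε hε] with ω h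
      rw [Real.norm_of_nonneg h.1]
      exact h.2
    have hsi : Integrable (s ε) (P ε) := Integrable.of_bound (hms ε).aestronglyMeasurable Smax <| by
      filter_upwards [hs_bdd ε hε] with ω h
      rw [Real.norm_of_nonneg h.1]
      exact h.2
    rw [integral_sub hai hsi, hEa ε hε, hEs ε hε]
    ring
  have hEu {ε : ℝ} (hε : ε ∈ Set.Ioo 0 μ) : ∫ ω, u ε ω ∂(P ε) = ε := by
    have hqi : Integrable (q ε) (P ε) :=
      integrable_of_integrable_exp_mul (hmq ε) (hq0 ε hε) (mul_pos hΘ hε.1)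
        (hmgf ε hε Θ (abs_of_pos hΘ).le)
    have hXi : Integrable (X ε) (P ε) :=
      Integrable.of_bound (hXm ε).aestronglyMeasurable M (hXb hε)
    have := stationary_queue_integral_idle (hmq ε) (hXm ε) hqi hXi (hstatX hε)
    rw [hEX hε, neg_neg] at this
    exact this
  have hEX2 {ε : ℝ} (hε : ε ∈ Set.Ioo 0 μ) :
      ∫ ω, X ε ω ^ 2 ∂(P ε) = σa' ε ^ 2 + σs ^ 2 + ε ^ 2 := by
    have h := integral_sub_sq_of_indepFun (P := P ε) (A := Amax) (S := Smax) (hma ε) (hms ε)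
      (by filter_upwards [ha_bdd ε hε] with ω h using (abs_of_nonneg h.1).trans_le h.2)
      (by filter_upwards [hs_bdd ε hε] with ω h using (abs_of_nonneg h.1).trans_le h.2)
      (h_a_s ε hε)
    rw [hEa ε hε, hEs ε hε, hVara ε hε, hVars ε hε] at h
    rw [h]
    ring
  have hV : Tendsto (fun ε => σa' ε ^ 2 + σs ^ 2 + ε ^ 2) (𝓝[>] 0) (𝓝 (σa ^ 2 + σs ^ 2)) := by
    have hε : Tendsto (fun ε : ℝ => ε) (𝓝[>] 0) (𝓝 0) :=
      tendsto_nhdsWithin_of_tendsto_nhds tendsto_id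
    simpa using ((hσa'lim.pow 2).add_const (σs ^ 2)).add (hε.pow 2)
  have hmem {ε : ℝ} (hε : ε ∈ Set.Ioo 0 (min μ (|t| * M)⁻¹)) : ε ∈ Set.Ioo 0 μ :=
    ⟨hε.1, hε.2.trans_le (min_le_left _ _)⟩
  have hsmall {ε : ℝ} (hε : ε ∈ Set.Ioo 0 (min μ (|t| * M)⁻¹)) : |t * ε| * M ≤ 1 := by
    have h1 : ε ≤ (|t| * M)⁻¹ := (hε.2.trans_le (min_le_right _ _)).le
    have h2 := mul_le_mul_of_nonneg_left h1 htM.le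
    rw [mul_inv_cancel₀ htM.ne'] at h2
    rw [abs_mul, abs_of_pos hε.1]
    linarith
  refine tendsto_of_mul_eq_of_norm_sub_le (C := t ^ 2 * M) (K := (|t| * M) ^ 3)
    (D := fun ε => 1 - ∫ ω, Complex.exp ((t * ε * X ε ω : ℝ) * Complex.I) ∂(P ε))
    (N := fun ε => 1 - ∫ ω, Complex.exp ((-(t * ε) * u ε ω : ℝ) * Complex.I) ∂(P ε))
    hδ ht hpos hV (fun ε hε => ?_) (fun ε hε => ?_) (fun ε hε => ?_)
  · have hind : IndepFun (X ε) (q ε) (P ε) :=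
      (h_as_q ε (hmem hε)).comp (measurable_fst.sub measurable_snd) measurable_id
    exact stationary_queue_charFun (hmq ε) (hXm ε) hind (hstatX (hmem hε)) (t * ε)
  · have h := norm_integral_cexp_sub_le (w := -(t * ε)) (hum ε) (hub (hmem hε))
      (by simpa only [abs_neg] using hsmall hε)
    rw [hEu (hmem hε), ← norm_neg] at h
    refine (le_of_eq ?_).trans (h.trans (le_of_eq (by ring)))
    congr 1
    push_cast
    ring
  · have h := norm_integral_cexp_sub_add_le (hXm ε) (hXb (hmem hε)) (hsmall hε)
    rw [hEX (hmem hε), hEX2 (hmem hε), ← norm_neg] at h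
    refine (le_of_eq ?_).trans (h.trans (le_of_eq ?_))
    · congr 1
      push_cast
      ring
    · rw [abs_mul, abs_of_pos hε.1]
      ring
end

section
/- Fix n ≥ 1, a vector c ∈ ℝⁿ with c ≥ 0 componentwise and ‖c‖ = 1, b > 0, r ∈ ℝⁿ with ⟨c, r⟩ = b, constants A_max, S_max, B_max > 0, σ_B ≥ 0, a symmetric matrix (Σ^a_{ij}) with Σ_{i,j} c_i c_j Σ^a_{ij} + σ_B² > 0, constants Θ > 0, C₀ < ∞, θ* > 0, C* < ∞, K < ∞, and ν ∈ (0, π/2]. For each ε ∈ (0, 1), let q̄_ε, ā_ε, s̄_ε be ℝⁿ-valued random vectors and B̄_ε a real random variable on a common probability space such that: q̄_ε ≥ 0 a.s.; 0 ≤ (ā_ε)_i ≤ A_max a.s., E[ā_ε] = r − ε c, and Cov((ā_ε)_i, (ā_ε)_j) → Σ^a_{ij} as ε → 0⁺ for all i, j; 0 ≤ (s̄_ε)_i ≤ S_max a.s.; 0 ≤ ⟨c, s̄_ε⟩ ≤ B̄_ε ≤ B_max a.s., E[B̄_ε] = b, Var(B̄_ε) = σ_B²; ā_ε is independent of the triple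 (q̄_ε, s̄_ε, B̄_ε), and B̄_ε is independent of q̄_ε; the coordinatewise update (q̄_ε⁺)_i := max((q̄_ε)_i + (ā_ε)_i − (s̄_ε)_i, 0) yields q̄_ε⁺ identically distributed with q̄_ε; E[e^{θ ε ⟨c, q̄_ε⟩}] ≤ C₀ for all |θ| ≤ Θ and all ε; the state space collapse bound E[e^{θ* ‖(q̄_ε)_⊥‖}] ≤ C* holds for all ε, where (q̄_ε)_⊥ := q̄_ε − ⟨c, q̄_ε⟩ c; P(B̄_ε ≠ ⟨c, s̄_ε⟩) ≤ K ε; and a.s. on {B̄_ε ≠ ⟨c, s̄_ε⟩}, ⟨c, q̄_ε⟩ ≤ cot(ν) ‖(q̄_ε)_⊥‖. Then, as ε → 0⁺, the law of ε·q̄_ε converges weakly (as a measure on ℝⁿ) to the law of Ῡ·c, where Ῡ is an exponential random variable with mean (Σ_{i=1}^n Σ_{j=1}^n c_i c_j Σ^a_{ij} + σ_B²)/2. -/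
open MeasureTheory ProbabilityTheory Filter Topology


/-- The unit complex number `exp (i x)`. -/
noncomputable def phase (x : ℝ) : ℂ := Complex.exp (Complex.I * x)

lemma phase_add (x y : ℝ) : phase (x + y) = phase x * phase y := by
  simp [phase, mul_add, Complex.exp_add]

lemma norm_phase (x : ℝ) : ‖phase x‖ = 1 := Complex.norm_exp_I_mul_ofReal x

lemma norm_phase_sub_one_le (x : ℝ) : ‖phase x - 1‖ ≤ |x| :=
  Real.norm_exp_I_mul_ofReal_sub_one_le

@[fun_prop]
lemma continuous_phase : Continuous phase := by unfold phase; fun_prop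

lemma norm_phase_sub_one_sub_le (x : ℝ) :
    ‖phase x - 1 - Complex.I * x‖ ≤ 2 * x ^ 2 := by
  rcases le_total |x| 1 with hx | hx
  · have h := Complex.norm_exp_sub_one_sub_id_le (x := Complex.I * x) (by simpa using hx)
    simp only [norm_mul, Complex.norm_I, one_mul, Complex.norm_real, Real.norm_eq_abs,
      sq_abs] at h
    exact h.trans (by nlinarith [sq_nonneg x])
  · calc ‖phase x - 1 - Complex.I * x‖ ≤ ‖phase x - 1‖ + ‖Complex.I * x‖ := norm_sub_le _ _
      _ ≤ |x| + |x| := by gcongr; exacts [norm_phase_sub_one_le x, by simp]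
      _ ≤ 2 * x ^ 2 := by nlinarith [sq_abs x]

lemma norm_phase_sub_taylor_two_le (x : ℝ) :
    ‖phase x - (1 + Complex.I * x - (x : ℂ) ^ 2 / 2)‖ ≤ |x| ^ 3 * Real.exp |x| := by
  have h := Complex.norm_exp_sub_sum_le_norm_mul_exp (Complex.I * x) 3
  simp only [Finset.sum_range_succ, Finset.sum_range_zero, Nat.factorial, norm_mul,
    Complex.norm_I, one_mul, Complex.norm_real, Real.norm_eq_abs, mul_pow, Complex.I_sq] at h
  refine le_trans (le_of_eq ?_) h
  congr 1
  unfold phase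
  push_cast
  ring

/-- Pointwise second-order error in the one-step balance of `phase (τ * q)`. -/
lemma norm_phase_balance_le (τ q g v u q' : ℝ) (h : q' = q + g + v + u) :
    ‖phase (τ * q) * phase (τ * g) - phase (τ * q') + Complex.I * (τ * (u + v) : ℝ)‖ ≤
      2 * τ ^ 2 * (|q'| * |u| + u ^ 2 + |q| * |v| + |g| * |v| + v ^ 2) := by
  have hsplit : phase (τ * q') * phase (τ * (-u)) =
      phase (τ * q) * phase (τ * g) * phase (τ * v) := by
    simp only [← phase_add]; congr 1; rw [h]; ring
  have hid : phase (τ * q) * phase (τ * g) - phase (τ * q') + Complex.I * (τ * (u + v) : ℝ) =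
      (phase (τ * q') - 1) * (phase (τ * (-u)) - 1)
      + (phase (τ * (-u)) - 1 - Complex.I * (τ * (-u) : ℝ))
      - (phase (τ * q) - 1) * phase (τ * g) * (phase (τ * v) - 1)
      - (phase (τ * g) - 1) * (phase (τ * v) - 1)
      - (phase (τ * v) - 1 - Complex.I * (τ * v : ℝ)) := by
    push_cast
    linear_combination -hsplit
  have b1 : ‖(phase (τ * q') - 1) * (phase (τ * (-u)) - 1)‖ ≤ τ ^ 2 * (|q'| * |u|) := by
    rw [norm_mul]
    calc _ ≤ |τ * q'| * |τ * (-u)| := by gcongr <;> exact norm_phase_sub_one_le _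
      _ = _ := by rw [abs_mul, abs_mul, abs_neg, ← sq_abs τ]; ring
  have b2 : ‖phase (τ * (-u)) - 1 - Complex.I * (τ * (-u) : ℝ)‖ ≤ 2 * τ ^ 2 * u ^ 2 :=
    (norm_phase_sub_one_sub_le _).trans_eq (by ring)
  have b3 : ‖(phase (τ * q) - 1) * phase (τ * g) * (phase (τ * v) - 1)‖ ≤
      τ ^ 2 * (|q| * |v|) := by
    rw [norm_mul, norm_mul, norm_phase, mul_one]
    calc _ ≤ |τ * q| * |τ * v| := by gcongr <;> exact norm_phase_sub_one_le _
      _ = _ := by rw [abs_mul, abs_mul, ← sq_abs τ]; ring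
  have b4 : ‖(phase (τ * g) - 1) * (phase (τ * v) - 1)‖ ≤ τ ^ 2 * (|g| * |v|) := by
    rw [norm_mul]
    calc _ ≤ |τ * g| * |τ * v| := by gcongr <;> exact norm_phase_sub_one_le _
      _ = _ := by rw [abs_mul, abs_mul, ← sq_abs τ]; ring
  have b5 : ‖phase (τ * v) - 1 - Complex.I * (τ * v : ℝ)‖ ≤ 2 * τ ^ 2 * v ^ 2 :=
    (norm_phase_sub_one_sub_le _).trans_eq (by ring)
  rw [hid]
  refine (norm_sub_le _ _).trans ((add_le_add ((norm_sub_le _ _).trans (add_le_add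
    ((norm_sub_le _ _).trans (add_le_add ((norm_add_le _ _).trans (add_le_add b1 b2)) b3))
    b4)) b5).trans ?_)
  have : 0 ≤ τ ^ 2 * (|q'| * |u|) + τ ^ 2 * (|q| * |v|) + τ ^ 2 * (|g| * |v|) := by positivity
  linarith

lemma integrable_phase {Ω : Type*} [MeasurableSpace Ω] {P : Measure Ω} [IsFiniteMeasure P]
    {Y : Ω → ℝ} (hY : AEMeasurable Y P) : Integrable (fun ω => phase (Y ω)) P :=
  Integrable.of_bound (continuous_phase.comp_aestronglyMeasurable hY.aestronglyMeasurable) 1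
    (ae_of_all _ fun _ => (norm_phase _).le)

/-- Young's inequality with weight `δ`, for a factor `u` in `[0, m]`. -/
lemma mul_le_weighted_sq_add {x u m δ : ℝ} (hδ : 0 < δ) (hu : 0 ≤ u) (hum : u ≤ m) :
    x * u ≤ δ * x ^ 2 + m * δ⁻¹ * u := by
  have h1 : 0 ≤ δ⁻¹ * (δ * x - u) ^ 2 := by positivity
  have h2 : δ⁻¹ * (δ * x - u) ^ 2 = δ * x ^ 2 - 2 * (x * u) + δ⁻¹ * u ^ 2 := by
    field_simp; ring
  have h3 : δ⁻¹ * u ^ 2 ≤ m * δ⁻¹ * u := by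
    have : δ⁻¹ * (u * u) ≤ δ⁻¹ * (m * u) := by gcongr
    nlinarith
  have h4 : 0 ≤ δ * x ^ 2 := by positivity
  have h5 : 0 ≤ m * δ⁻¹ * u := by
    have := hu.trans hum; positivity
  linarith

/-- One-step balance of the characteristic function of a stationary scalar recursion
`Q' = Q + G + V + U` with drift `-ε`. -/
lemma norm_charFun_balance_le {Ω : Type*} [MeasurableSpace Ω] {P : Measure Ω}
    [IsProbabilityMeasure P] {Q Q' G V U X X' : Ω → ℝ} {ε τ M κ D Um Vm Gm : ℝ}
    (hε : 0 < ε) (hε1 : ε ≤ 1) (hM : 0 ≤ M) (hκ : 0 ≤ κ)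
    (hQ : Integrable Q P) (hQ' : Integrable Q' P) (hG : Integrable G P)
    (hVi : Integrable V P) (hUi : Integrable U P)
    (hEQ : ∫ ω, Q' ω ∂P = ∫ ω, Q ω ∂P) (hEG : ∫ ω, G ω ∂P = -ε)
    (hupd : ∀ᵐ ω ∂P, Q' ω = Q ω + G ω + V ω + U ω)
    (hU : ∀ᵐ ω ∂P, 0 ≤ U ω ∧ U ω ≤ Um) (hV : ∀ᵐ ω ∂P, 0 ≤ V ω ∧ V ω ≤ Vm)
    (hGb : ∀ᵐ ω ∂P, |G ω| ≤ Gm)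
    (hQ'U : ∀ᵐ ω ∂P, |Q' ω| * U ω ≤ M * (X' ω * U ω))
    (hQV : ∀ᵐ ω ∂P, |Q ω| * V ω ≤ κ * (X ω * V ω))
    (hX : Integrable (fun ω => X ω ^ 2) P) (hX' : Integrable (fun ω => X' ω ^ 2) P)
    (hXD : ∫ ω, X ω ^ 2 ∂P ≤ D) (hX'D : ∫ ω, X' ω ^ 2 ∂P ≤ D)
    (hchar : ∫ ω, phase (τ * Q' ω) ∂P = ∫ ω, phase (τ * Q ω) ∂P)
    (hmul : ∫ ω, phase (τ * Q ω) * phase (τ * G ω) ∂P =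
      (∫ ω, phase (τ * Q ω) ∂P) * ∫ ω, phase (τ * G ω) ∂P) :
    ‖(∫ ω, phase (τ * Q ω) ∂P) * ((∫ ω, phase (τ * G ω) ∂P) - 1) + Complex.I * (τ * ε : ℝ)‖ ≤
      2 * τ ^ 2 * (√ε * ((M + κ) * D + (M * Um + κ * Vm + Um + Gm + Vm))) := by
  set δ := √ε with hδdef
  have hδ : 0 < δ := Real.sqrt_pos.2 hε
  have hδε : δ * δ = ε := Real.mul_self_sqrt hε.le
  have hδ1 : 1 ≤ δ⁻¹ := (one_le_inv₀ hδ).2 (Real.sqrt_le_one.2 hε1)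
  set L := M * Um + κ * Vm + Um + Gm + Vm with hL
  have hEUV : ∫ ω, (U ω + V ω) ∂P = ε := by
    have h1 : ∫ ω, (U ω + V ω) ∂P = ∫ ω, (Q' ω - Q ω - G ω) ∂P :=
      integral_congr_ae (by filter_upwards [hupd] with ω h; rw [h]; ring)
    rw [h1, integral_sub (f := fun ω => Q' ω - Q ω) (hQ'.sub hQ) hG, integral_sub hQ' hQ, hEQ, hEG]; ring
  have hpQ : Integrable (fun ω => phase (τ * Q ω)) P :=
    integrable_phase (hQ.aemeasurable.const_mul τ)
  have hpQ' : Integrable (fun ω => phase (τ * Q' ω)) P :=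
    integrable_phase (hQ'.aemeasurable.const_mul τ)
  have hpQG : Integrable (fun ω => phase (τ * Q ω) * phase (τ * G ω)) P := by
    simp only [← phase_add]
    exact integrable_phase ((hQ.aemeasurable.const_mul τ).add (hG.aemeasurable.const_mul τ))
  have hUV : Integrable (fun ω => ((τ * (U ω + V ω) : ℝ) : ℂ)) P :=
    ((hUi.add hVi).const_mul τ).ofReal
  have hexpand : (∫ ω, phase (τ * Q ω) ∂P) * ((∫ ω, phase (τ * G ω) ∂P) - 1)
      + Complex.I * (τ * ε : ℝ) =
      ∫ ω, (phase (τ * Q ω) * phase (τ * G ω) - phase (τ * Q' ω)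
        + Complex.I * (τ * (U ω + V ω) : ℝ)) ∂P := by
    have hd : Integrable (fun ω => phase (τ * Q ω) * phase (τ * G ω) - phase (τ * Q' ω)) P :=
      hpQG.sub hpQ'
    rw [integral_add hd (hUV.const_mul _), integral_sub hpQG hpQ', hmul, hchar,
      integral_const_mul, integral_complex_ofReal, integral_const_mul, hEUV]
    ring
  have hbi : Integrable (fun ω => 2 * τ ^ 2 *
      (δ * (M * X' ω ^ 2 + κ * X ω ^ 2) + L * δ⁻¹ * (U ω + V ω))) P :=
    ((((hX'.const_mul M).add (hX.const_mul κ)).const_mul δ).add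
      ((hUi.add hVi).const_mul _)).const_mul _
  rw [hexpand]
  refine (norm_integral_le_of_norm_le hbi ?_).trans ?_
  · filter_upwards [hupd, hU, hV, hGb, hQ'U, hQV] with ω h1 hu hv hg h2 h3
    refine (norm_phase_balance_le τ _ _ _ _ _ h1).trans ?_
    refine mul_le_mul_of_nonneg_left ?_ (by positivity)
    rw [abs_of_nonneg hu.1, abs_of_nonneg hv.1]
    have k1 := mul_le_mul_of_nonneg_left
      (mul_le_weighted_sq_add (x := X' ω) hδ hu.1 hu.2) hM
    have k2 := mul_le_mul_of_nonneg_left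
      (mul_le_weighted_sq_add (x := X ω) hδ hv.1 hv.2) hκ
    have hUm : 0 ≤ Um := hu.1.trans hu.2
    have hVm : 0 ≤ Vm := hv.1.trans hv.2
    have hGm : 0 ≤ Gm := (abs_nonneg _).trans hg
    have k3 : U ω ^ 2 ≤ δ⁻¹ * (Um * U ω) := by
      calc U ω ^ 2 = 1 * (U ω * U ω) := by ring
        _ ≤ _ := by have := hu.1; gcongr; exact hu.2
    have k4 : V ω ^ 2 ≤ δ⁻¹ * (Vm * V ω) := by
      calc V ω ^ 2 = 1 * (V ω * V ω) := by ring
        _ ≤ _ := by have := hv.1; gcongr; exact hv.2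
    have k5 : |G ω| * V ω ≤ δ⁻¹ * (Gm * V ω) := by
      calc |G ω| * V ω = 1 * (|G ω| * V ω) := by ring
        _ ≤ _ := by have := hv.1; gcongr
    have hu0 := hu.1
    have hv0 := hv.1
    have k6 : L * δ⁻¹ * (U ω + V ω) = M * (Um * δ⁻¹ * U ω) + κ * (Vm * δ⁻¹ * V ω)
        + δ⁻¹ * (Um * U ω) + δ⁻¹ * (Vm * V ω) + δ⁻¹ * (Gm * V ω)
        + δ⁻¹ * ((M * Um + Um) * V ω + (κ * Vm + Vm + Gm) * U ω) := by
      rw [hL]; ring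
    have k7 : 0 ≤ δ⁻¹ * ((M * Um + Um) * V ω + (κ * Vm + Vm + Gm) * U ω) := by positivity
    rw [k6]
    linarith
  · rw [integral_const_mul, integral_add
      (((hX'.const_mul M).fun_add (hX.const_mul κ)).const_mul δ)
      ((hUi.fun_add hVi).const_mul _), integral_const_mul, integral_const_mul, hEUV,
      integral_add (hX'.const_mul M) (hX.const_mul κ), integral_const_mul, integral_const_mul]
    refine mul_le_mul_of_nonneg_left ?_ (by positivity)
    have e1 : L * δ⁻¹ * ε = δ * L := by rw [← hδε]; field_simp
    rw [e1, mul_add]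
    have : M * ∫ ω, X' ω ^ 2 ∂P ≤ M * D := by gcongr
    have : κ * ∫ ω, X ω ^ 2 ∂P ≤ κ * D := by gcongr
    have : δ * (M * ∫ ω, X' ω ^ 2 ∂P + κ * ∫ ω, X ω ^ 2 ∂P) ≤ δ * ((M + κ) * D) := by
      gcongr; linarith
    linarith

/-- Second-order expansion of the characteristic function of a bounded variable. -/
lemma norm_integral_phase_sub_taylor_le {Ω : Type*} [MeasurableSpace Ω] {P : Measure Ω}
    [IsProbabilityMeasure P] {G : Ω → ℝ} {τ Gm : ℝ} (hG : AEMeasurable G P)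
    (hGb : ∀ᵐ ω ∂P, |G ω| ≤ Gm) :
    ‖(∫ ω, phase (τ * G ω) ∂P) - 1 - Complex.I * (τ * ∫ ω, G ω ∂P : ℝ)
      + (τ ^ 2 / 2 * ∫ ω, G ω ^ 2 ∂P : ℝ)‖ ≤ (|τ| * Gm) ^ 3 * Real.exp (|τ| * Gm) := by
  have hGi : Integrable G P := Integrable.of_bound hG.aestronglyMeasurable Gm hGb
  have hG2 : Integrable (fun ω => G ω ^ 2) P :=
    Integrable.of_bound (hG.pow_const 2).aestronglyMeasurable (Gm ^ 2) (by
      filter_upwards [hGb] with ω h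
      rw [norm_pow, Real.norm_eq_abs]; gcongr)
  have hp : Integrable (fun ω => phase (τ * G ω)) P := integrable_phase (hG.const_mul τ)
  have i1 : Integrable (fun ω => Complex.I * ((τ * G ω : ℝ) : ℂ)) P :=
    ((hGi.const_mul τ).ofReal (𝕜 := ℂ)).const_mul _
  have i2 : Integrable (fun ω => ((τ ^ 2 / 2 * G ω ^ 2 : ℝ) : ℂ)) P :=
    (hG2.const_mul _).ofReal
  have hexpand : (∫ ω, phase (τ * G ω) ∂P) - 1 - Complex.I * (τ * ∫ ω, G ω ∂P : ℝ)
      + (τ ^ 2 / 2 * ∫ ω, G ω ^ 2 ∂P : ℝ) =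
      ∫ ω, (phase (τ * G ω) - 1 - Complex.I * ((τ * G ω : ℝ) : ℂ)
        + ((τ ^ 2 / 2 * G ω ^ 2 : ℝ) : ℂ)) ∂P := by
    have d1 : Integrable (fun ω => phase (τ * G ω) - 1) P := hp.sub (integrable_const 1)
    have d2 : Integrable (fun ω => phase (τ * G ω) - 1 - Complex.I * ((τ * G ω : ℝ) : ℂ)) P :=
      d1.sub i1
    rw [integral_add d2 i2,
      integral_sub d1 i1, integral_sub hp (integrable_const 1),
      integral_const_mul, integral_complex_ofReal, integral_complex_ofReal, integral_const_mul,
      integral_const_mul]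
    simp
  rw [hexpand]
  refine (norm_integral_le_of_norm_le_const (C := (|τ| * Gm) ^ 3 * Real.exp (|τ| * Gm))
    ?_).trans_eq (by simp)
  filter_upwards [hGb] with ω h
  calc _ = ‖phase (τ * G ω) - (1 + Complex.I * (τ * G ω : ℝ) - ((τ * G ω : ℝ) : ℂ) ^ 2 / 2)‖ := by
        congr 1; push_cast; ring
    _ ≤ |τ * G ω| ^ 3 * Real.exp |τ * G ω| := norm_phase_sub_taylor_two_le _
    _ ≤ _ := by
        have := (abs_nonneg _).trans h
        rw [abs_mul]; gcongr

/-- Passage to the limit in the balance equation. -/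
lemma tendsto_of_balance {φ ψ : ℝ → ℂ} {v : ℝ → ℝ} {t σ C C' : ℝ} (ht : t ≠ 0) (hσ : 0 < σ)
    (hv : Tendsto v (𝓝[>] 0) (𝓝 σ))
    (h1 : ∀ᶠ ε in 𝓝[>] (0 : ℝ), ‖φ ε * (ψ ε - 1) + Complex.I * (t * ε * ε : ℝ)‖ ≤ C * ε ^ 2 * √ε)
    (h2 : ∀ᶠ ε in 𝓝[>] (0 : ℝ), ‖ψ ε - 1 + Complex.I * (t * ε * ε : ℝ)
      + ((t * ε) ^ 2 / 2 * v ε : ℝ)‖ ≤ C' * ε ^ 3) :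
    Tendsto φ (𝓝[>] 0) (𝓝 (((2 / σ : ℝ) : ℂ) / ((2 / σ : ℝ) - Complex.I * t))) := by
  have hpos : ∀ᶠ ε in 𝓝[>] (0 : ℝ), 0 < ε := eventually_mem_nhdsWithin
  have hid : Tendsto (fun ε : ℝ => ε) (𝓝[>] 0) (𝓝 0) := tendsto_nhdsWithin_of_tendsto_nhds tendsto_id
  have hnum : Tendsto (fun ε : ℝ => φ ε * (ψ ε - 1) / ((ε ^ 2 : ℝ) : ℂ)) (𝓝[>] 0)
      (𝓝 (-(Complex.I * t))) := by
    rw [tendsto_iff_norm_sub_tendsto_zero]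
    refine squeeze_zero' (Eventually.of_forall fun _ => norm_nonneg _)
      (g := fun ε => C * √ε) ?_ ?_
    · filter_upwards [h1, hpos] with ε h hε
      have hε' : (ε : ℂ) ≠ 0 := by exact_mod_cast hε.ne'
      have : φ ε * (ψ ε - 1) / ((ε ^ 2 : ℝ) : ℂ) - -(Complex.I * t) =
          (φ ε * (ψ ε - 1) + Complex.I * (t * ε * ε : ℝ)) / ((ε ^ 2 : ℝ) : ℂ) := by
        push_cast; field_simp; ring
      rw [this, norm_div, Complex.norm_real, Real.norm_of_nonneg (by positivity),
        div_le_iff₀ (by positivity)]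
      linarith
    · simpa using ((Real.continuous_sqrt.tendsto 0).comp hid).const_mul C
  have hden : Tendsto (fun ε : ℝ => (ψ ε - 1) / ((ε ^ 2 : ℝ) : ℂ)) (𝓝[>] 0)
      (𝓝 (-(Complex.I * t) - ((t ^ 2 / 2 * σ : ℝ) : ℂ))) := by
    have hv' : Tendsto (fun ε => -(Complex.I * t) - ((t ^ 2 / 2 * v ε : ℝ) : ℂ)) (𝓝[>] 0)
        (𝓝 (-(Complex.I * t) - ((t ^ 2 / 2 * σ : ℝ) : ℂ))) :=
      tendsto_const_nhds.sub ((Complex.continuous_ofReal.tendsto _).comp (hv.const_mul _))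
    have hd : Tendsto (fun ε : ℝ => (ψ ε - 1) / ((ε ^ 2 : ℝ) : ℂ)
        - (-(Complex.I * t) - ((t ^ 2 / 2 * v ε : ℝ) : ℂ))) (𝓝[>] 0) (𝓝 0) := by
      rw [tendsto_zero_iff_norm_tendsto_zero]
      refine squeeze_zero' (Eventually.of_forall fun _ => norm_nonneg _)
        (g := fun ε => C' * ε) ?_ ?_
      · filter_upwards [h2, hpos] with ε h hε
        have hε' : (ε : ℂ) ≠ 0 := by exact_mod_cast hε.ne'
        have : (ψ ε - 1) / ((ε ^ 2 : ℝ) : ℂ) - (-(Complex.I * t) - ((t ^ 2 / 2 * v ε : ℝ) : ℂ)) =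
            (ψ ε - 1 + Complex.I * (t * ε * ε : ℝ) + ((t * ε) ^ 2 / 2 * v ε : ℝ))
              / ((ε ^ 2 : ℝ) : ℂ) := by
          push_cast; field_simp; ring
        rw [this, norm_div, Complex.norm_real, Real.norm_of_nonneg (by positivity),
          div_le_iff₀ (by positivity)]
        linarith
      · simpa using hid.const_mul C'
    simpa using hd.add hv'
  have hne : -(Complex.I * t) - ((t ^ 2 / 2 * σ : ℝ) : ℂ) ≠ 0 := by
    intro h
    have := congrArg Complex.im h
    simp only [Complex.sub_im, Complex.neg_im, Complex.mul_im, Complex.ofReal_im,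
      Complex.I_re, Complex.I_im, Complex.ofReal_re, Complex.zero_im] at this
    exact ht (by linarith)
  have hlim : -(Complex.I * t) / (-(Complex.I * t) - ((t ^ 2 / 2 * σ : ℝ) : ℂ)) =
      ((2 / σ : ℝ) : ℂ) / ((2 / σ : ℝ) - Complex.I * t) := by
    have hσ' : (σ : ℂ) ≠ 0 := by exact_mod_cast hσ.ne'
    have hne' : ((2 / σ : ℝ) : ℂ) - Complex.I * t ≠ 0 := by
      intro h
      have := congrArg Complex.im h
      simp only [Complex.sub_im, Complex.mul_im, Complex.ofReal_im,
        Complex.I_re, Complex.I_im, Complex.ofReal_re, Complex.zero_im] at this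
      exact ht (by linarith)
    rw [div_eq_div_iff hne hne']
    push_cast
    field_simp
    linear_combination (σ * t : ℂ) * t * Complex.I_sq
  rw [← hlim]
  refine (hnum.div hden hne).congr' ?_
  filter_upwards [hden.eventually_ne hne, hpos] with ε h hε
  have hε' : ((ε ^ 2 : ℝ) : ℂ) ≠ 0 := by exact_mod_cast (pow_pos hε 2).ne'
  have hψ : ψ ε - 1 ≠ 0 := fun h0 => h (by rw [h0, zero_div])
  simp only [Pi.div_apply]
  field_simp

/-- Characteristic function of the exponential distribution. -/
lemma integral_phase_expMeasure {ρ : ℝ} (hρ : 0 < ρ) (t : ℝ) :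
    ∫ x, phase (t * x) ∂(expMeasure ρ) = (ρ : ℂ) / (ρ - Complex.I * t) := by
  have hm : Measurable (exponentialPDF ρ) := (measurable_exponentialPDFReal ρ).ennreal_ofReal
  have hdef : expMeasure ρ = volume.withDensity (exponentialPDF ρ) := rfl
  rw [hdef, integral_withDensity_eq_integral_toReal_smul hm
    (ae_of_all _ fun x => ENNReal.ofReal_lt_top)]
  have hind : (fun x => (exponentialPDF ρ x).toReal • phase (t * x)) =
      (Set.Ici (0 : ℝ)).indicator fun x => (ρ : ℂ) * Complex.exp ((-ρ + Complex.I * t) * x) := by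
    ext x
    by_cases hx : 0 ≤ x
    · rw [Set.indicator_of_mem (Set.mem_Ici.2 hx), exponentialPDF_of_nonneg hx,
        ENNReal.toReal_ofReal (by positivity), phase, Complex.real_smul, add_mul, Complex.exp_add]
      push_cast
      rw [mul_assoc]
      congr 3 <;> ring_nf
    · rw [Set.indicator_of_notMem (by simpa using hx), exponentialPDF_of_neg (not_le.1 hx)]
      simp
  rw [hind, integral_indicator measurableSet_Ici, integral_Ici_eq_integral_Ioi,
    integral_const_mul, integral_exp_mul_complex_Ioi (by simpa using hρ)]
  have : (ρ : ℂ) - Complex.I * t = -(-ρ + Complex.I * t) := by ring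
  rw [this, Complex.ofReal_zero, mul_zero, Complex.exp_zero, div_neg, neg_div, mul_neg, mul_one_div]

/-- Lévy's convergence theorem on `Fin n → ℝ`, along an arbitrary countably generated filter. -/
lemma tendsto_integral_of_tendsto_integral_phase {ι : Type*} {l : Filter ι}
    [l.IsCountablyGenerated] {n : ℕ} {μ : ι → Measure (Fin n → ℝ)}
    [∀ k, IsProbabilityMeasure (μ k)] {μ₀ : Measure (Fin n → ℝ)} [IsProbabilityMeasure μ₀]
    (h : ∀ t : Fin n → ℝ, Tendsto (fun k => ∫ x, phase (∑ i, t i * x i) ∂(μ k)) l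
      (𝓝 (∫ x, phase (∑ i, t i * x i) ∂μ₀)))
    (f : BoundedContinuousFunction (Fin n → ℝ) ℝ) :
    Tendsto (fun k => ∫ x, f x ∂(μ k)) l (𝓝 (∫ x, f x ∂μ₀)) := by
  have hm : Measurable (WithLp.toLp 2 : (Fin n → ℝ) → EuclideanSpace ℝ (Fin n)) := by fun_prop
  have hprob (m : Measure (Fin n → ℝ)) [IsProbabilityMeasure m] :
      IsProbabilityMeasure (m.map (WithLp.toLp 2 : (Fin n → ℝ) → EuclideanSpace ℝ (Fin n))) :=
    Measure.isProbabilityMeasure_map hm.aemeasurable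
  have hchar (m : Measure (Fin n → ℝ)) (t : EuclideanSpace ℝ (Fin n)) :
      charFun (m.map (WithLp.toLp 2 : (Fin n → ℝ) → EuclideanSpace ℝ (Fin n))) t =
        ∫ x, phase (∑ i, t i * x i) ∂m := by
    rw [charFun_apply, integral_map hm.aemeasurable (by fun_prop)]
    simp [phase, PiLp.inner_apply, mul_comm]
  refine tendsto_of_seq_tendsto fun u hu => ?_
  have hlevy := (ProbabilityMeasure.tendsto_iff_tendsto_charFun
    (μ₀ := ⟨_, hprob μ₀⟩) (μ := fun k => ⟨_, hprob (μ (u k))⟩)).2 (fun t => by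
      simp only [ProbabilityMeasure.coe_mk, hchar]
      exact (h t.ofLp).comp hu)
  have hf := ProbabilityMeasure.tendsto_iff_forall_integral_tendsto.1 hlevy
    (f.compContinuous ⟨fun x : EuclideanSpace ℝ (Fin n) => x.ofLp, by fun_prop⟩)
  have hexpand (m : Measure (Fin n → ℝ)) :
      ∫ x, (f.compContinuous ⟨fun x : EuclideanSpace ℝ (Fin n) => x.ofLp, by fun_prop⟩) x
        ∂(m.map (WithLp.toLp 2 : (Fin n → ℝ) → EuclideanSpace ℝ (Fin n))) = ∫ x, f x ∂m := by
    rw [integral_map hm.aemeasurable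
      (BoundedContinuousFunction.continuous _).aestronglyMeasurable]
    rfl
  simpa only [ProbabilityMeasure.coe_mk, hexpand, Function.comp_def] using hf

/-- The Euclidean length of `q - ⟨c, q⟩ c`. -/
noncomputable def perpNorm {n : ℕ} (c q : Fin n → ℝ) : ℝ :=
  √(∑ i, (q i - (∑ j, c j * q j) * c i) ^ 2)

lemma perpNorm_nonneg {n : ℕ} (c q : Fin n → ℝ) : 0 ≤ perpNorm c q := Real.sqrt_nonneg _

lemma continuous_perpNorm {n : ℕ} (c : Fin n → ℝ) : Continuous (perpNorm c) := by
  unfold perpNorm; fun_prop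

lemma abs_sub_le_perpNorm {n : ℕ} (c q : Fin n → ℝ) (i : Fin n) :
    |q i - (∑ j, c j * q j) * c i| ≤ perpNorm c q := by
  rw [← Real.sqrt_sq_eq_abs]
  exact Real.sqrt_le_sqrt (Finset.single_le_sum
    (f := fun i => (q i - (∑ j, c j * q j) * c i) ^ 2) (fun _ _ => sq_nonneg _)
    (Finset.mem_univ i))

/-- Complementary slackness of `q` and `u` turns `⟨c, q⟩ ⟨c, u⟩` into a multiple of the
perpendicular component of `q`. -/
lemma sum_mul_sum_le_perpNorm {n : ℕ} {c q u : Fin n → ℝ} (hc : ∀ i, 0 ≤ c i)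
    (hu : ∀ i, 0 ≤ u i) (hqu : ∀ i, q i * u i = 0) :
    (∑ i, c i * q i) * (∑ i, c i * u i) ≤
      (∑ i, (c i)⁻¹) * (perpNorm c q * ∑ i, c i * u i) := by
  rw [Finset.mul_sum, Finset.sum_mul]
  refine Finset.sum_le_sum fun i _ => ?_
  have hX := perpNorm_nonneg c q
  have hU : 0 ≤ ∑ i, c i * u i := Finset.sum_nonneg fun j _ => mul_nonneg (hc j) (hu j)
  have hi : c i * u i ≤ ∑ i, c i * u i :=
    Finset.single_le_sum (f := fun i => c i * u i) (fun j _ => mul_nonneg (hc j) (hu j))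
      (Finset.mem_univ i)
  rcases (hc i).eq_or_lt with h0 | h0
  · simp [← h0]
  rcases (hu i).eq_or_lt with h1 | h1
  · rw [← h1, mul_zero, mul_zero]; positivity
  have hq : q i = 0 := (mul_eq_zero.1 (hqu i)).resolve_right h1.ne'
  have h2 : (∑ j, c j * q j) * c i ≤ perpNorm c q := by
    have := abs_sub_le_perpNorm c q i
    rw [hq, zero_sub, abs_neg] at this
    exact (le_abs_self _).trans this
  calc (∑ j, c j * q j) * (c i * u i) = ((∑ j, c j * q j) * c i) * ((c i)⁻¹ * (c i * u i)) := by
        field_simp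
    _ ≤ perpNorm c q * ((c i)⁻¹ * ∑ i, c i * u i) := by gcongr
    _ = _ := by ring

/-- Second moments are controlled by exponential moments. -/
lemma integrable_sq_and_integral_sq_le {Ω : Type*} [MeasurableSpace Ω] {P : Measure Ω}
    {X : Ω → ℝ} {θ C : ℝ} (hθ : 0 < θ) (hX : AEMeasurable X P) (hX0 : ∀ ω, 0 ≤ X ω)
    (hi : Integrable (fun ω => Real.exp (θ * X ω)) P)
    (hC : ∫ ω, Real.exp (θ * X ω) ∂P ≤ C) :
    Integrable (fun ω => X ω ^ 2) P ∧ ∫ ω, X ω ^ 2 ∂P ≤ 2 / θ ^ 2 * C := by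
  have hle (ω : Ω) : X ω ^ 2 ≤ 2 / θ ^ 2 * Real.exp (θ * X ω) := by
    have h := Real.quadratic_le_exp_of_nonneg (mul_nonneg hθ.le (hX0 ω))
    have h0 := mul_nonneg hθ.le (hX0 ω)
    rw [div_mul_eq_mul_div, le_div_iff₀ (by positivity)]
    nlinarith
  have hsq : Integrable (fun ω => X ω ^ 2) P :=
    (hi.const_mul (2 / θ ^ 2)).mono' (hX.pow_const 2).aestronglyMeasurable
      (ae_of_all _ fun ω => by rw [Real.norm_of_nonneg (sq_nonneg _)]; exact hle ω)
  refine ⟨hsq, ?_⟩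
  calc ∫ ω, X ω ^ 2 ∂P ≤ ∫ ω, 2 / θ ^ 2 * Real.exp (θ * X ω) ∂P :=
        integral_mono hsq (hi.const_mul _) hle
    _ ≤ _ := by rw [integral_const_mul]; gcongr

/-- For `A` independent of `(Q, B)` and `B` independent of `Q`, the characteristic functions of
`Q` and `A - B` multiply. -/
lemma integral_phase_mul_phase_sub {Ω : Type*} [MeasurableSpace Ω] {P : Measure Ω}
    {Q A B : Ω → ℝ} (hQ : Measurable Q) (hA : Measurable A)
    (hB : Measurable B) (hAQB : IndepFun A (fun ω => (Q ω, B ω)) P) (hBQ : IndepFun B Q P)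
    (τ : ℝ) :
    ∫ ω, phase (τ * Q ω) * phase (τ * (A ω - B ω)) ∂P =
      (∫ ω, phase (τ * Q ω) ∂P) * ∫ ω, phase (τ * (A ω - B ω)) ∂P := by
  have hp (Y : Ω → ℝ) (hY : Measurable Y) (s : ℝ) :
      AEStronglyMeasurable (fun ω => phase (s * Y ω)) P :=
    continuous_phase.comp_aestronglyMeasurable (hY.const_mul s).aestronglyMeasurable
  have hm (s : ℝ) : Measurable fun x : ℝ => phase (s * x) :=
    continuous_phase.measurable.comp (measurable_const_mul s)
  have hsub (ω : Ω) : phase (τ * (A ω - B ω)) = phase (τ * A ω) * phase (-τ * B ω) := by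
    rw [← phase_add]; congr 1; ring
  have h1 : ∫ ω, phase (τ * A ω) * (phase (τ * Q ω) * phase (-τ * B ω)) ∂P =
      (∫ ω, phase (τ * A ω) ∂P) * ∫ ω, phase (τ * Q ω) * phase (-τ * B ω) ∂P :=
    (hAQB.comp (hm τ) (ψ := fun p : ℝ × ℝ => phase (τ * p.1) * phase (-τ * p.2))
      (((hm τ).comp measurable_fst).mul ((hm (-τ)).comp
        measurable_snd))).integral_fun_mul_eq_mul_integral (hp A hA τ)
      ((hp Q hQ τ).mul (hp B hB (-τ)))
  have h2 : ∫ ω, phase (τ * Q ω) * phase (-τ * B ω) ∂P =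
      (∫ ω, phase (τ * Q ω) ∂P) * ∫ ω, phase (-τ * B ω) ∂P :=
    (hBQ.symm.comp (hm τ) (hm (-τ))).integral_fun_mul_eq_mul_integral (hp Q hQ τ)
      (hp B hB (-τ))
  have h3 : ∫ ω, phase (τ * A ω) * phase (-τ * B ω) ∂P =
      (∫ ω, phase (τ * A ω) ∂P) * ∫ ω, phase (-τ * B ω) ∂P :=
    (hAQB.comp (hm τ) (ψ := fun p : ℝ × ℝ => phase (-τ * p.2))
      ((hm (-τ)).comp measurable_snd)).integral_fun_mul_eq_mul_integral (hp A hA τ)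
      (hp B hB (-τ))
  simp only [hsub]
  rw [h3]
  calc _ = ∫ ω, phase (τ * A ω) * (phase (τ * Q ω) * phase (-τ * B ω)) ∂P := by
        congr 1; ext ω; ring
    _ = _ := by rw [h1, h2]; ring

/-- Second moment of a difference of independent variables, by centering. -/
lemma integral_sub_sq_of_indepFun_s16 {Ω : Type*} [MeasurableSpace Ω] {P : Measure Ω}
    [IsProbabilityMeasure P] {A B : Ω → ℝ} (hA : MemLp A 2 P) (hB : MemLp B 2 P)
    (hAB : IndepFun A B P) {α β : ℝ} (hα : ∫ ω, A ω ∂P = α) (hβ : ∫ ω, B ω ∂P = β) :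
    ∫ ω, (A ω - B ω) ^ 2 ∂P =
      ∫ ω, (A ω - α) ^ 2 ∂P + ∫ ω, (B ω - β) ^ 2 ∂P + (α - β) ^ 2 := by
  have h1 : Var[A - B; P] = Var[A; P] + Var[B; P] := by
    have hneg : IndepFun A (-B) P := hAB.comp measurable_id measurable_neg
    rw [sub_eq_add_neg, hneg.variance_add hA hB.neg, variance_neg]
  have hAi : Integrable A P := hA.integrable one_le_two
  have hBi : Integrable B P := hB.integrable one_le_two
  have h2 := variance_eq_sub (hA.sub hB)
  rw [h1, variance_eq_integral hA.aemeasurable, variance_eq_integral hB.aemeasurable,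
    hα, hβ] at h2
  simp only [Pi.pow_apply, Pi.sub_apply] at h2
  rw [integral_sub hAi hBi, hα, hβ] at h2
  linarith

/-- Balance equation for the switch in steady state at load parameter `ε`. -/
lemma switch_balance {n : ℕ} {c : Fin n → ℝ} (hc : ∀ i, 0 ≤ c i)
    {b ε Amax Smax Bmax Θ θ C κ : ℝ} (hε : ε ∈ Set.Ioo (0 : ℝ) 1)
    (hΘ : 0 < Θ) (hθ : 0 < θ) (hκ : 0 ≤ κ)
    {Ω : Type*} [MeasurableSpace Ω] {P : Measure Ω} [IsProbabilityMeasure P]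
    {q a s : Ω → Fin n → ℝ} {B : Ω → ℝ}
    (hmq : Measurable q) (hma : Measurable a) (hms : Measurable s) (hmB : Measurable B)
    (hq0 : ∀ᵐ ω ∂P, ∀ i, 0 ≤ q ω i) (ha : ∀ᵐ ω ∂P, ∀ i, a ω i ∈ Set.Icc 0 Amax)
    (hEA : ∫ ω, ∑ i, c i * a ω i ∂P = b - ε)
    (hs : ∀ᵐ ω ∂P, ∀ i, s ω i ∈ Set.Icc 0 Smax)
    (hsB : ∀ᵐ ω ∂P, 0 ≤ ∑ i, c i * s ω i ∧ (∑ i, c i * s ω i) ≤ B ω ∧ B ω ≤ Bmax)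
    (hEB : ∫ ω, B ω ∂P = b)
    (haq : IndepFun a (fun ω => (q ω, s ω, B ω)) P) (hBq : IndepFun B q P)
    (hstat : P.map (fun ω (i : Fin n) => max (q ω i + a ω i - s ω i) 0) = P.map q)
    (hmgf : Integrable (fun ω => Real.exp (Θ * ε * ∑ i, c i * q ω i)) P)
    (hXi : Integrable (fun ω => Real.exp (θ * perpNorm c (q ω))) P)
    (hXC : ∫ ω, Real.exp (θ * perpNorm c (q ω)) ∂P ≤ C)
    (halign : ∀ᵐ ω ∂P, B ω ≠ (∑ i, c i * s ω i) →
      (∑ i, c i * q ω i) ≤ κ * perpNorm c (q ω)) (τ : ℝ) :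
    ‖(∫ ω, phase (τ * ∑ i, c i * q ω i) ∂P) *
        ((∫ ω, phase (τ * ((∑ i, c i * a ω i) - B ω)) ∂P) - 1) + Complex.I * (τ * ε : ℝ)‖ ≤
      2 * τ ^ 2 * (√ε * (((∑ i, (c i)⁻¹) + κ) * (2 / θ ^ 2 * C) +
        ((∑ i, (c i)⁻¹) * (∑ i, c i * Smax) + κ * Bmax + (∑ i, c i * Smax)
          + ((∑ i, c i * Amax) + Bmax) + Bmax))) := by
  set q' : Ω → Fin n → ℝ := fun ω i => max (q ω i + a ω i - s ω i) 0 with hq'def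
  have hmq' : Measurable q' := by fun_prop
  have hdot : Continuous fun x : Fin n → ℝ => ∑ i, c i * x i := by fun_prop
  have hident : IdentDistrib q' q P P := ⟨hmq'.aemeasurable, hmq.aemeasurable, hstat⟩
  have hQ0 : ∀ᵐ ω ∂P, 0 ≤ ∑ i, c i * q ω i := by
    filter_upwards [hq0] with ω h using Finset.sum_nonneg fun i _ => mul_nonneg (hc i) (h i)
  have hQ : Integrable (fun ω => ∑ i, c i * q ω i) P := by
    refine (hmgf.const_mul (Θ * ε)⁻¹).mono'
      (hdot.measurable.comp hmq).aestronglyMeasurable ?_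
    filter_upwards [hQ0] with ω h
    have hpos : 0 < Θ * ε := mul_pos hΘ hε.1
    rw [Real.norm_of_nonneg h, inv_mul_eq_div, le_div_iff₀ hpos]
    have := Real.add_one_le_exp (Θ * ε * ∑ i, c i * q ω i)
    linarith
  have hidQ := hident.comp hdot.measurable
  have hX2 := integrable_sq_and_integral_sq_le hθ
    ((continuous_perpNorm c).measurable.comp hmq).aemeasurable
    (fun ω => perpNorm_nonneg c (q ω)) hXi hXC
  have hidX := hident.comp ((continuous_perpNorm c).measurable.pow_const 2)
  have hA0 : ∀ᵐ ω ∂P, 0 ≤ ∑ i, c i * a ω i ∧ ∑ i, c i * a ω i ≤ ∑ i, c i * Amax := by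
    filter_upwards [ha] with ω h
    exact ⟨Finset.sum_nonneg fun i _ => mul_nonneg (hc i) (h i).1,
      Finset.sum_le_sum fun i _ => mul_le_mul_of_nonneg_left (h i).2 (hc i)⟩
  have hG : ∀ᵐ ω ∂P, |(∑ i, c i * a ω i) - B ω| ≤ (∑ i, c i * Amax) + Bmax := by
    filter_upwards [hA0, hsB] with ω h1 h2
    rw [abs_le]; constructor <;> linarith [h1.1, h1.2, h2.1, h2.2.1, h2.2.2]
  have hmA : Measurable fun ω => ∑ i, c i * a ω i := hdot.measurable.comp hma
  have hmS : Measurable fun ω => ∑ i, c i * s ω i := hdot.measurable.comp hms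
  have hAi : Integrable (fun ω => ∑ i, c i * a ω i) P :=
    Integrable.of_bound hmA.aestronglyMeasurable (∑ i, c i * Amax) (by
      filter_upwards [hA0] with ω h
      rw [Real.norm_of_nonneg h.1]; exact h.2)
  have hBi : Integrable B P :=
    Integrable.of_bound hmB.aestronglyMeasurable Bmax (by
      filter_upwards [hsB] with ω h
      rw [Real.norm_of_nonneg (h.1.trans h.2.1)]; exact h.2.2)
  have hV : ∀ᵐ ω ∂P, 0 ≤ B ω - ∑ i, c i * s ω i ∧ B ω - ∑ i, c i * s ω i ≤ Bmax := by
    filter_upwards [hsB] with ω h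
    constructor <;> linarith [h.1, h.2.1, h.2.2]
  set u : Ω → Fin n → ℝ := fun ω i => q' ω i - (q ω i + a ω i - s ω i) with hu
  have hmu : Measurable u := by fun_prop
  have hu0 (ω : Ω) (i : Fin n) : 0 ≤ u ω i := sub_nonneg.2 (le_max_left _ _)
  have hcomp (ω : Ω) (i : Fin n) : q' ω i * u ω i = 0 := by
    rcases le_total (q ω i + a ω i - s ω i) 0 with h | h
    · simp [hq'def, max_eq_right h]
    · simp [hu, hq'def, max_eq_left h]
  have huS : ∀ᵐ ω ∂P, ∀ i, u ω i ≤ Smax := by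
    filter_upwards [hq0, ha, hs] with ω h1 h2 h3 i
    have h2' := (h2 i).1
    have h3' := h3 i
    have h1' := h1 i
    have : q' ω i ≤ q ω i + a ω i - s ω i + Smax :=
      max_le (by linarith [h3'.1, h3'.2]) (by linarith [h3'.2])
    simp only [hu]; linarith
  have hU : ∀ᵐ ω ∂P, 0 ≤ ∑ i, c i * u ω i ∧ ∑ i, c i * u ω i ≤ ∑ i, c i * Smax := by
    filter_upwards [huS] with ω h
    exact ⟨Finset.sum_nonneg fun i _ => mul_nonneg (hc i) (hu0 ω i),
      Finset.sum_le_sum fun i _ => mul_le_mul_of_nonneg_left (h i) (hc i)⟩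
  have hchar : ∫ ω, phase (τ * ∑ i, c i * q' ω i) ∂P = ∫ ω, phase (τ * ∑ i, c i * q ω i) ∂P :=
    (hidQ.comp (continuous_phase.measurable.comp (measurable_const_mul τ))).integral_eq
  have hAQB : IndepFun (fun ω => ∑ i, c i * a ω i) (fun ω => (∑ i, c i * q ω i, B ω)) P :=
    haq.comp hdot.measurable (ψ := fun p : (Fin n → ℝ) × (Fin n → ℝ) × ℝ =>
      (∑ i, c i * p.1 i, p.2.2))
      ((hdot.measurable.comp measurable_fst).prodMk (measurable_snd.comp measurable_snd))
  have hBQ : IndepFun B (fun ω => ∑ i, c i * q ω i) P := hBq.comp measurable_id hdot.measurable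
  have hmul := integral_phase_mul_phase_sub (hdot.measurable.comp hmq) hmA hmB hAQB hBQ τ
  refine norm_charFun_balance_le (P := P) (Q := fun ω => ∑ i, c i * q ω i)
    (Q' := fun ω => ∑ i, c i * q' ω i) (G := fun ω => (∑ i, c i * a ω i) - B ω)
    (V := fun ω => B ω - ∑ i, c i * s ω i) (U := fun ω => ∑ i, c i * u ω i)
    (X := fun ω => perpNorm c (q ω)) (X' := fun ω => perpNorm c (q' ω))
    hε.1 hε.2.le (Finset.sum_nonneg fun i _ => inv_nonneg.2 (hc i)) hκ hQ
    (hidQ.integrable_iff.2 hQ) (hAi.sub hBi) ?_ ?_ hidQ.integral_eq ?_ ?_ hU hV hG ?_ ?_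
    hX2.1 (hidX.integrable_iff.2 hX2.1) hX2.2 (hidX.integral_eq.trans_le hX2.2) hchar hmul
  · exact Integrable.of_bound (hmB.sub hmS).aestronglyMeasurable Bmax (by
      filter_upwards [hV] with ω h
      rw [Real.norm_of_nonneg h.1]; exact h.2)
  · exact Integrable.of_bound (hdot.measurable.comp hmu).aestronglyMeasurable
      (∑ i, c i * Smax) (by
        filter_upwards [hU] with ω h
        rw [Real.norm_of_nonneg h.1]; exact h.2)
  · rw [integral_sub hAi hBi, hEA, hEB]; ring
  · refine ae_of_all _ fun ω => ?_
    simp only [hu, mul_sub, mul_add, Finset.sum_sub_distrib, Finset.sum_add_distrib]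
    ring
  · refine ae_of_all _ fun ω => ?_
    have hQ'0 : 0 ≤ ∑ i, c i * q' ω i :=
      Finset.sum_nonneg fun i _ => mul_nonneg (hc i) (le_max_right _ _)
    rw [abs_of_nonneg hQ'0]
    exact sum_mul_sum_le_perpNorm hc (hu0 ω) (hcomp ω)
  · filter_upwards [hQ0, hV, halign] with ω h1 h2 h3
    rw [abs_of_nonneg h1]
    by_cases h : B ω = ∑ i, c i * s ω i
    · simp [h]
    · rw [← mul_assoc]
      exact mul_le_mul_of_nonneg_right (h3 h) h2.1

/-- The variance of `∑ i, c i * a i` in terms of the covariances of the coordinates. -/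
lemma integral_sum_mul_sub_sq {n : ℕ} {Ω : Type*} [MeasurableSpace Ω] {P : Measure Ω}
    [IsProbabilityMeasure P] {c m : Fin n → ℝ} {a : Ω → Fin n → ℝ}
    (ha : ∀ i, MemLp (fun ω => a ω i) 2 P) :
    ∫ ω, ((∑ i, c i * a ω i) - ∑ i, c i * m i) ^ 2 ∂P =
      ∑ i, ∑ j, c i * c j * ∫ ω, (a ω i - m i) * (a ω j - m j) ∂P := by
  have hm (i : Fin n) : MemLp (fun ω => a ω i - m i) 2 P := (ha i).sub (memLp_const _)
  have hi (i j : Fin n) : Integrable (fun ω => (a ω i - m i) * (a ω j - m j)) P :=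
    (hm i).integrable_mul (hm j)
  have hexp (ω : Ω) : ((∑ i, c i * a ω i) - ∑ i, c i * m i) ^ 2 =
      ∑ i, ∑ j, c i * c j * ((a ω i - m i) * (a ω j - m j)) := by
    rw [← Finset.sum_sub_distrib, sq, Finset.sum_mul_sum]
    exact Finset.sum_congr rfl fun i _ => Finset.sum_congr rfl fun j _ => by ring
  simp only [hexp]
  rw [integral_finsetSum _ fun i _ => integrable_finsetSum _ fun j _ => (hi i j).const_mul _]
  refine Finset.sum_congr rfl fun i _ => ?_
  rw [integral_finsetSum _ fun j _ => (hi i j).const_mul _]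
  exact Finset.sum_congr rfl fun j _ => integral_const_mul _ _

/-- State space collapse: characteristic functions of `ε q` and of `ε ⟨c, q⟩ c` are close. -/
lemma norm_integral_phase_sub_le_perpNorm {n : ℕ} {Ω : Type*} [MeasurableSpace Ω]
    {P : Measure Ω} [IsProbabilityMeasure P] {c t : Fin n → ℝ} {q : Ω → Fin n → ℝ}
    (hmq : Measurable q) {ε D : ℝ} (hε : 0 ≤ ε)
    (hX : Integrable (fun ω => perpNorm c (q ω) ^ 2) P)
    (hD : ∫ ω, perpNorm c (q ω) ^ 2 ∂P ≤ D) :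
    ‖(∫ ω, phase (∑ i, t i * (ε * q ω i)) ∂P) -
      ∫ ω, phase ((∑ i, t i * c i) * ε * ∑ i, c i * q ω i) ∂P‖ ≤
      ε * ((∑ i, |t i|) * (D + 1)) := by
  have hbi : Integrable (fun ω => ε * ((∑ i, |t i|) * (perpNorm c (q ω) ^ 2 + 1))) P :=
    ((hX.add (integrable_const 1)).const_mul _).const_mul _
  rw [← integral_sub (integrable_phase (by fun_prop)) (integrable_phase (by fun_prop))]
  refine (norm_integral_le_of_norm_le hbi (ae_of_all _ fun ω => ?_)).trans ?_
  · set x := ∑ i, t i * (ε * q ω i) with hx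
    set y := (∑ i, t i * c i) * ε * ∑ i, c i * q ω i with hy
    have hxy : x = y + (x - y) := by ring
    have hd : x - y = ε * ∑ i, t i * (q ω i - (∑ j, c j * q ω j) * c i) := by
      rw [hx, hy]
      simp only [mul_sub, Finset.sum_sub_distrib, Finset.mul_sum, Finset.sum_mul]
      congr 1
      · exact Finset.sum_congr rfl fun i _ => by ring
      · rw [Finset.sum_comm]
        exact Finset.sum_congr rfl fun i _ => Finset.sum_congr rfl fun j _ => by ring
    calc ‖phase x - phase y‖ = ‖phase y * (phase (x - y) - 1)‖ := by
          rw [mul_sub, ← phase_add, ← hxy, mul_one]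
      _ ≤ |x - y| := by rw [norm_mul, norm_phase, one_mul]; exact norm_phase_sub_one_le _
      _ ≤ ε * ∑ i, |t i| * perpNorm c (q ω) := by
          rw [hd, abs_mul, abs_of_nonneg hε]
          gcongr
          refine (Finset.abs_sum_le_sum_abs _ _).trans (Finset.sum_le_sum fun i _ => ?_)
          rw [abs_mul]
          gcongr
          exact abs_sub_le_perpNorm c (q ω) i
      _ ≤ _ := by
          rw [← Finset.sum_mul]
          have : perpNorm c (q ω) ≤ perpNorm c (q ω) ^ 2 + 1 := by
            nlinarith [sq_nonneg (perpNorm c (q ω) - 1), perpNorm_nonneg c (q ω)]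
          gcongr
  · rw [integral_const_mul, integral_const_mul, integral_add hX (integrable_const 1)]
    simp only [integral_const, probReal_univ, smul_eq_mul, mul_one]
    gcongr

/-- Heavy-traffic limit of the generalized switch under the CRP condition: the law
of `ε·q̄_ε` converges weakly to the law of `Ῡ·c`, where `Ῡ` is exponential with
mean `(Σᵢⱼ cᵢcⱼ Σᵃᵢⱼ + σ_B²)/2` (i.e. rate `2/(Σᵢⱼ cᵢcⱼ Σᵃᵢⱼ + σ_B²)`). -/
theorem stmt16
    (n : ℕ) (hn : 1 ≤ n) (c : Fin n → ℝ)
    (hc_nonneg : ∀ i, 0 ≤ c i) (hc_norm : Real.sqrt (∑ i, c i ^ 2) = 1)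
    (b : ℝ) (hb : 0 < b) (r : Fin n → ℝ) (hcr : ∑ i, c i * r i = b)
    (Amax Smax Bmax σB Θ C₀ θstar Cstar K ν : ℝ)
    (hA : 0 < Amax) (hS : 0 < Smax) (hBmax : 0 < Bmax) (hσB : 0 ≤ σB)
    (covA : Fin n → Fin n → ℝ) (hcovA_symm : ∀ i j, covA i j = covA j i)
    (hpos : 0 < (∑ i, ∑ j, c i * c j * covA i j) + σB ^ 2)
    (hΘ : 0 < Θ) (hθstar : 0 < θstar) (hν : ν ∈ Set.Ioc 0 (Real.pi / 2))
    (Ω : ℝ → Type) [∀ ε, MeasurableSpace (Ω ε)]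
    (P : ∀ ε, Measure (Ω ε)) [∀ ε, IsProbabilityMeasure (P ε)]
    (q a s : ∀ ε, Ω ε → Fin n → ℝ) (B : ∀ ε, Ω ε → ℝ)
    (hmq : ∀ ε, Measurable (q ε)) (hma : ∀ ε, Measurable (a ε))
    (hms : ∀ ε, Measurable (s ε)) (hmB : ∀ ε, Measurable (B ε))
    (hq0 : ∀ ε ∈ Set.Ioo (0:ℝ) 1, ∀ᵐ ω ∂(P ε), ∀ i, 0 ≤ q ε ω i)
    (ha_bdd : ∀ ε ∈ Set.Ioo (0:ℝ) 1, ∀ᵐ ω ∂(P ε), ∀ i, a ε ω i ∈ Set.Icc 0 Amax)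
    (hEa : ∀ ε ∈ Set.Ioo (0:ℝ) 1, ∀ i, ∫ ω, a ε ω i ∂(P ε) = r i - ε * c i)
    (hCova : ∀ i j, Tendsto (fun ε =>
        ∫ ω, (a ε ω i - (r i - ε * c i)) * (a ε ω j - (r j - ε * c j)) ∂(P ε))
      (𝓝[>] 0) (𝓝 (covA i j)))
    (hs_bdd : ∀ ε ∈ Set.Ioo (0:ℝ) 1, ∀ᵐ ω ∂(P ε), ∀ i, s ε ω i ∈ Set.Icc 0 Smax)
    (hsB : ∀ ε ∈ Set.Ioo (0:ℝ) 1, ∀ᵐ ω ∂(P ε),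
      0 ≤ ∑ i, c i * s ε ω i ∧ (∑ i, c i * s ε ω i) ≤ B ε ω ∧ B ε ω ≤ Bmax)
    (hEB : ∀ ε ∈ Set.Ioo (0:ℝ) 1, ∫ ω, B ε ω ∂(P ε) = b)
    (hVarB : ∀ ε ∈ Set.Ioo (0:ℝ) 1, ∫ ω, (B ε ω - b) ^ 2 ∂(P ε) = σB ^ 2)
    (h_a_indep : ∀ ε ∈ Set.Ioo (0:ℝ) 1,
      IndepFun (a ε) (fun ω => (q ε ω, s ε ω, B ε ω)) (P ε))
    (h_B_q : ∀ ε ∈ Set.Ioo (0:ℝ) 1, IndepFun (B ε) (q ε) (P ε))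
    (hstat : ∀ ε ∈ Set.Ioo (0:ℝ) 1,
      Measure.map (fun ω (i : Fin n) =>
        max (q ε ω i + a ε ω i - s ε ω i) 0) (P ε) = Measure.map (q ε) (P ε))
    (hmgf_int : ∀ ε ∈ Set.Ioo (0:ℝ) 1, ∀ θ : ℝ, |θ| ≤ Θ →
      Integrable (fun ω => Real.exp (θ * ε * ∑ i, c i * q ε ω i)) (P ε))
    (hmgf_bdd : ∀ ε ∈ Set.Ioo (0:ℝ) 1, ∀ θ : ℝ, |θ| ≤ Θ →
      (∫ ω, Real.exp (θ * ε * ∑ i, c i * q ε ω i) ∂(P ε)) ≤ C₀)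
    (hSSC_int : ∀ ε ∈ Set.Ioo (0:ℝ) 1,
      Integrable (fun ω => Real.exp (θstar *
        Real.sqrt (∑ i, (q ε ω i - (∑ j, c j * q ε ω j) * c i) ^ 2))) (P ε))
    (hSSC_bdd : ∀ ε ∈ Set.Ioo (0:ℝ) 1,
      (∫ ω, Real.exp (θstar *
        Real.sqrt (∑ i, (q ε ω i - (∑ j, c j * q ε ω j) * c i) ^ 2)) ∂(P ε))
        ≤ Cstar)
    (hprob : ∀ ε ∈ Set.Ioo (0:ℝ) 1,
      ((P ε) {ω | B ε ω ≠ ∑ i, c i * s ε ω i}).toReal ≤ K * ε)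
    (halign : ∀ ε ∈ Set.Ioo (0:ℝ) 1, ∀ᵐ ω ∂(P ε),
      B ε ω ≠ (∑ i, c i * s ε ω i) →
      (∑ i, c i * q ε ω i) ≤ Real.cot ν *
        Real.sqrt (∑ i, (q ε ω i - (∑ j, c j * q ε ω j) * c i) ^ 2)) :
    ∀ f : BoundedContinuousFunction (Fin n → ℝ) ℝ,
      Tendsto (fun ε => ∫ ω, f (fun i => ε * q ε ω i) ∂(P ε)) (𝓝[>] 0)
        (𝓝 (∫ x, f (fun i => x * c i)
          ∂(expMeasure (2 / ((∑ i, ∑ j, c i * c j * covA i j) + σB ^ 2))))) := by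
  set σ := (∑ i, ∑ j, c i * c j * covA i j) + σB ^ 2 with hσ
  have hρ : 0 < 2 / σ := by positivity
  have := isProbabilityMeasure_expMeasure hρ
  have hmε (ε : ℝ) : Measurable fun ω (i : Fin n) => ε * q ε ω i := by have := hmq ε; fun_prop
  have hmc : Measurable fun (x : ℝ) (i : Fin n) => x * c i := by fun_prop
  have (ε : ℝ) : IsProbabilityMeasure ((P ε).map fun ω (i : Fin n) => ε * q ε ω i) :=
    Measure.isProbabilityMeasure_map (hmε ε).aemeasurable
  have : IsProbabilityMeasure ((expMeasure (2 / σ)).map fun (x : ℝ) (i : Fin n) => x * c i) :=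
    Measure.isProbabilityMeasure_map hmc.aemeasurable
  have hcc : ∑ i, c i * c i = 1 := by
    have h := (Real.sqrt_eq_one).1 hc_norm
    simpa only [sq] using h
  have hIoo : ∀ᶠ ε in 𝓝[>] (0 : ℝ), ε ∈ Set.Ioo (0 : ℝ) 1 := Ioo_mem_nhdsGT one_pos
  have hid : Tendsto (fun ε : ℝ => ε) (𝓝[>] 0) (𝓝 0) :=
    tendsto_nhdsWithin_of_tendsto_nhds tendsto_id
  have haL (ε : ℝ) (hε : ε ∈ Set.Ioo (0 : ℝ) 1) (i : Fin n) :
      MemLp (fun ω => a ε ω i) 2 (P ε) :=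
    MemLp.of_bound (measurable_pi_apply i |>.comp (hma ε)).aestronglyMeasurable Amax (by
      filter_upwards [ha_bdd ε hε] with ω h
      rw [Real.norm_of_nonneg (h i).1]; exact (h i).2)
  have hmean (ε : ℝ) : ∑ i, c i * (r i - ε * c i) = b - ε := by
    have : ∑ i, c i * (r i - ε * c i) = ∑ i, c i * r i - ε * ∑ i, c i * c i := by
      rw [Finset.mul_sum, ← Finset.sum_sub_distrib]
      exact Finset.sum_congr rfl fun i _ => by ring
    rw [this, hcr, hcc, mul_one]
  have hEA (ε : ℝ) (hε : ε ∈ Set.Ioo (0 : ℝ) 1) :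
      ∫ ω, ∑ i, c i * a ε ω i ∂(P ε) = b - ε := by
    rw [integral_finsetSum _ fun i _ => ((haL ε hε i).integrable one_le_two).const_mul _,
      ← hmean ε]
    exact Finset.sum_congr rfl fun i _ => by rw [integral_const_mul, hEa ε hε i]
  have hmA (ε : ℝ) : Measurable fun ω => ∑ i, c i * a ε ω i := by have := hma ε; fun_prop
  have hAL (ε : ℝ) (hε : ε ∈ Set.Ioo (0 : ℝ) 1) :
      MemLp (fun ω => ∑ i, c i * a ε ω i) 2 (P ε) :=
    memLp_finsetSum _ fun i _ => (haL ε hε i).const_mul _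
  have hBL (ε : ℝ) (hε : ε ∈ Set.Ioo (0 : ℝ) 1) : MemLp (B ε) 2 (P ε) :=
    MemLp.of_bound (hmB ε).aestronglyMeasurable Bmax (by
      filter_upwards [hsB ε hε] with ω h
      rw [Real.norm_of_nonneg (h.1.trans h.2.1)]; exact h.2.2)
  have hGb (ε : ℝ) (hε : ε ∈ Set.Ioo (0 : ℝ) 1) :
      ∀ᵐ ω ∂(P ε), |(∑ i, c i * a ε ω i) - B ε ω| ≤ (∑ i, c i * Amax) + Bmax := by
    filter_upwards [ha_bdd ε hε, hsB ε hε] with ω h1 h2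
    have h3 : 0 ≤ ∑ i, c i * a ε ω i :=
      Finset.sum_nonneg fun i _ => mul_nonneg (hc_nonneg i) (h1 i).1
    have h4 : ∑ i, c i * a ε ω i ≤ ∑ i, c i * Amax :=
      Finset.sum_le_sum fun i _ => mul_le_mul_of_nonneg_left (h1 i).2 (hc_nonneg i)
    rw [abs_le]; constructor <;> linarith [h2.1, h2.2.1, h2.2.2]
  have hv : Tendsto (fun ε => ∫ ω, ((∑ i, c i * a ε ω i) - B ε ω) ^ 2 ∂(P ε)) (𝓝[>] 0)
      (𝓝 σ) := by
    have hlim : Tendsto (fun ε => (∑ i, ∑ j, c i * c j *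
        ∫ ω, (a ε ω i - (r i - ε * c i)) * (a ε ω j - (r j - ε * c j)) ∂(P ε))
          + σB ^ 2 + ε ^ 2) (𝓝[>] 0) (𝓝 (σ + 0 ^ 2)) :=
      ((tendsto_finsetSum _ fun i _ => tendsto_finsetSum _ fun j _ =>
        (hCova i j).const_mul _).add_const _).add (hid.pow 2)
    rw [zero_pow two_ne_zero, add_zero] at hlim
    refine hlim.congr' ?_
    filter_upwards [hIoo] with ε hε
    have hAB : IndepFun (fun ω => ∑ i, c i * a ε ω i) (B ε) (P ε) :=
      (h_a_indep ε hε).comp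
        (φ := fun x : Fin n → ℝ => ∑ i, c i * x i)
        (ψ := fun p : (Fin n → ℝ) × (Fin n → ℝ) × ℝ => p.2.2)
        (by fun_prop) (measurable_snd.comp measurable_snd)
    rw [integral_sub_sq_of_indepFun_s16 (hAL ε hε) (hBL ε hε) hAB (hEA ε hε) (hEB ε hε),
      hVarB ε hε, ← hmean ε, integral_sum_mul_sub_sq (haL ε hε), hmean ε]
    ring
  have hscalar (t : ℝ) : Tendsto (fun ε => ∫ ω, phase (t * ε * ∑ i, c i * q ε ω i) ∂(P ε))
      (𝓝[>] 0) (𝓝 (((2 / σ : ℝ) : ℂ) / ((2 / σ : ℝ) - Complex.I * t))) := by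
    rcases eq_or_ne t 0 with rfl | ht
    · have hσ0 : (((2 / σ : ℝ) : ℝ) : ℂ) ≠ 0 := by exact_mod_cast hρ.ne'
      have h1 : phase 0 = 1 := by simp [phase]
      simp only [zero_mul, h1, integral_const, probReal_univ, one_smul, Complex.ofReal_zero,
        mul_zero, sub_zero, div_self hσ0]
      exact tendsto_const_nhds
    set Gm := (∑ i, c i * Amax) + Bmax with hGm
    have hGm0 : 0 ≤ Gm :=
      add_nonneg (Finset.sum_nonneg fun i _ => mul_nonneg (hc_nonneg i) hA.le) hBmax.le
    refine tendsto_of_balance (ψ := fun ε =>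
        ∫ ω, phase (t * ε * ((∑ i, c i * a ε ω i) - B ε ω)) ∂(P ε))
      (C := 2 * t ^ 2 * (((∑ i, (c i)⁻¹) + |Real.cot ν|) * (2 / θstar ^ 2 * Cstar) +
        ((∑ i, (c i)⁻¹) * (∑ i, c i * Smax) + |Real.cot ν| * Bmax + (∑ i, c i * Smax)
          + Gm + Bmax)))
      (C' := (|t| * Gm) ^ 3 * Real.exp (|t| * Gm)) ht hpos hv ?_ ?_
    · filter_upwards [hIoo] with ε hε
      refine (switch_balance hc_nonneg hε hΘ hθstar (abs_nonneg (Real.cot ν)) (hmq ε)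
        (hma ε) (hms ε) (hmB ε) (hq0 ε hε) (ha_bdd ε hε) (hEA ε hε) (hs_bdd ε hε) (hsB ε hε)
        (hEB ε hε) (h_a_indep ε hε) (h_B_q ε hε) (hstat ε hε)
        (hmgf_int ε hε Θ (abs_of_pos hΘ).le) (hSSC_int ε hε) (hSSC_bdd ε hε) ?_
        (t * ε)).trans_eq ?_
      · filter_upwards [halign ε hε] with ω h hne
        exact (h hne).trans (mul_le_mul_of_nonneg_right (le_abs_self _) (Real.sqrt_nonneg _))
      · rw [← hGm]; ring
    · filter_upwards [hIoo] with ε hε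
      have h := norm_integral_phase_sub_taylor_le (τ := t * ε)
        ((hmA ε).sub (hmB ε)).aemeasurable (hGb ε hε)
      have hEG : ∫ ω, ((∑ i, c i * a ε ω i) - B ε ω) ∂(P ε) = -ε := by
        rw [integral_sub ((hAL ε hε).integrable one_le_two) ((hBL ε hε).integrable one_le_two),
          hEA ε hε, hEB ε hε]
        ring
      simp only [Pi.sub_apply, hEG] at h
      have hle : |t * ε| * Gm ≤ |t| * Gm := by
        rw [abs_mul, abs_of_pos hε.1]
        have : |t| * ε ≤ |t| := mul_le_of_le_one_right (abs_nonneg t) hε.2.le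
        gcongr
      calc _ = _ := by congr 1; push_cast; ring
        _ ≤ _ := h
        _ ≤ (|t * ε| * Gm) ^ 3 * Real.exp (|t| * Gm) := by gcongr
        _ = _ := by rw [abs_mul, abs_of_pos hε.1]; ring
  intro f
  have hmain := tendsto_integral_of_tendsto_integral_phase (l := 𝓝[>] (0 : ℝ))
    (μ := fun ε => (P ε).map fun ω (i : Fin n) => ε * q ε ω i)
    (μ₀ := (expMeasure (2 / σ)).map fun (x : ℝ) (i : Fin n) => x * c i) ?_ f
  · rw [integral_map hmc.aemeasurable f.continuous.aestronglyMeasurable] at hmain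
    refine hmain.congr fun ε => ?_
    rw [integral_map (hmε ε).aemeasurable f.continuous.aestronglyMeasurable]
  · intro t
    have hcont : Continuous fun x : Fin n → ℝ => phase (∑ i, t i * x i) := by fun_prop
    rw [integral_map hmc.aemeasurable hcont.aestronglyMeasurable]
    have hdir (x : ℝ) : ∑ i, t i * (x * c i) = (∑ i, t i * c i) * x := by
      rw [Finset.sum_mul]; exact Finset.sum_congr rfl fun i _ => by ring
    simp only [hdir]
    rw [integral_phase_expMeasure hρ]
    have hdiff : Tendsto (fun ε => (∫ ω, phase (∑ i, t i * (ε * q ε ω i)) ∂(P ε)) -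
        ∫ ω, phase ((∑ i, t i * c i) * ε * ∑ i, c i * q ε ω i) ∂(P ε)) (𝓝[>] 0) (𝓝 0) := by
      rw [tendsto_zero_iff_norm_tendsto_zero]
      refine squeeze_zero' (Eventually.of_forall fun _ => norm_nonneg _)
        (g := fun ε => ε * ((∑ i, |t i|) * (2 / θstar ^ 2 * Cstar + 1))) ?_ ?_
      · filter_upwards [hIoo] with ε hε
        obtain ⟨hX, hD⟩ := integrable_sq_and_integral_sq_le hθstar
          ((continuous_perpNorm c).measurable.comp (hmq ε)).aemeasurable
          (fun ω => perpNorm_nonneg c (q ε ω)) (hSSC_int ε hε) (hSSC_bdd ε hε)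
        exact norm_integral_phase_sub_le_perpNorm (hmq ε) hε.1.le hX hD
      · simpa using hid.mul_const ((∑ i, |t i|) * (2 / θstar ^ 2 * Cstar + 1))
    have hsum := hdiff.add (hscalar (∑ i, t i * c i))
    simp only [sub_add_cancel, zero_add] at hsum
    refine hsum.congr fun ε => ?_
    rw [integral_map (hmε ε).aemeasurable hcont.aestronglyMeasurable]
end
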